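/- arXiv:2508.14287 — 3 statements merged into one kernel-verified Lean document; each statement's English description precedes it below -/
import Mathlib

section
/- There is an absolute constant C such that for every integer n ≥ 2 that is a power of two and every power of two β with 1 ≤ β ≤ log₂ n, there is a deterministic online sorting algorithm with known range that uses an array with at most β·n·log₂ n middle cells and has cost at most C·log₂ n/β on every sequence of n elements of [0,1]. -/
/-!
Online sorting with known range (see stmt_0 for the model).

STATEMENT 4: there is an absolute constant `C` such that for every power of two `n = 2^k ≥ 2`
and every power of two `β = 2^j` with `1 ≤ β ≤ log₂ n` (i.e. `2^j ≤ k`), there is a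
deterministic online algorithm using at most `β n log₂ n` middle cells whose cost is at most
`C log₂ n / β` on every input of `n` elements of `[0,1]`.
-/

noncomputable section
attribute [local instance] Classical.propDecidable

/-- Cost of a configuration `g` of optional values in cells `0, …, N-1`: the sum of
`|x - y|` over all pairs of values occupying consecutive non-empty cells. -/
def configCost {N : ℕ} (g : Fin N → Option ℝ) : ℝ :=
  ∑ i : Fin N, ∑ j : Fin N,
    if (g i).isSome = true ∧ (g j).isSome = true ∧ i < j ∧
        (∀ k : Fin N, i < k → k < j → g k = none) then
      |(g i).getD 0 - (g j).getD 0|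
    else 0

/-- The cell in which the deterministic online algorithm `strat` (which sees exactly the
elements revealed so far) places the `t`-th element of the input sequence `a`. -/
def place {n m : ℕ} (strat : List ℝ → Fin m) (a : Fin n → ℝ) (t : Fin n) : Fin m :=
  strat ((List.ofFn a).take (t.1 + 1))

/-- The final configuration of the array with `m` middle cells and sentinels `0` and `1`
at the two ends, when element `a t` has been placed in middle cell `pl t`. -/
def withSentinels {n m : ℕ} (a : Fin n → ℝ) (pl : Fin n → Fin m) :
    Fin (m + 2) → Option ℝ := fun i =>
  if i.1 = 0 then some 0
  else if i.1 = m + 1 then some 1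
  else if h : ∃ t, (pl t).1 + 1 = i.1 then some (a h.choose) else none

def consec {N : ℕ} (g : Fin N → Option ℝ) (i j : Fin N) : Prop :=
  (g i).isSome = true ∧ (g j).isSome = true ∧ i < j ∧
        (∀ k : Fin N, i < k → k < j → g k = none)

def Wv {N : ℕ} (g : Fin N → Option ℝ) (f : Fin N → ℝ) : ℝ :=
  ∑ i : Fin N, ∑ j : Fin N, if consec g i j then |f i - f j| else 0

lemma Wv_add {N : ℕ} (g : Fin N → Option ℝ) (f h : Fin N → ℝ) :
    Wv g (fun i => f i + h i) ≤ Wv g f + Wv g h := by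
  unfold Wv
  rw [← Finset.sum_add_distrib]
  refine Finset.sum_le_sum fun i _ => ?_
  rw [← Finset.sum_add_distrib]
  refine Finset.sum_le_sum fun j _ => ?_
  split_ifs
  · calc |f i + h i - (f j + h j)| = |(f i - f j) + (h i - h j)| := by ring_nf
      _ ≤ _ := abs_add_le _ _
  · simp

lemma Wv_smul {N : ℕ} (g : Fin N → Option ℝ) (c : ℝ) (f : Fin N → ℝ) :
    Wv g (fun i => c * f i) = |c| * Wv g f := by
  unfold Wv
  rw [Finset.mul_sum]
  refine Finset.sum_congr rfl fun i _ => ?_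
  rw [Finset.mul_sum]
  refine Finset.sum_congr rfl fun j _ => ?_
  split_ifs
  · rw [← mul_sub, abs_mul]
  · simp

lemma Wv_sum {N : ℕ} (g : Fin N → Option ℝ) {ι : Type*} (s : Finset ι) (f : ι → Fin N → ℝ) :
    Wv g (fun i => ∑ a ∈ s, f a i) ≤ ∑ a ∈ s, Wv g (f a) := by
  induction s using Finset.induction_on with
  | empty => simp [Wv]
  | insert a s ha ih =>
    simp only [Finset.sum_insert ha]
    exact (Wv_add g _ _).trans (by linarith)

lemma Wv_mono {N : ℕ} (g : Fin (N+1) → Option ℝ) (f : Fin (N+1) → ℝ) (hf : Monotone f) :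
    Wv g f ≤ f (Fin.last N) - f 0 := by
  set h : ℕ → ℝ := fun p => f ⟨min p N, by omega⟩ with hh
  have hmono : Monotone h := fun p q hpq => hf (by simp only [Fin.mk_le_mk]; omega)
  have hfi : ∀ i : Fin (N+1), f i = h i.1 := by
    intro i; simp only [hh]; congr 1; ext; simp; omega
  set T : Finset (Fin (N+1) × Fin (N+1)) := Finset.univ.filter (fun x => consec g x.1 x.2) with hT
  have e1 : Wv g f = ∑ x ∈ T, ∑ p ∈ Finset.Ico x.1.1 x.2.1, (h (p+1) - h p) := by
    unfold Wv
    rw [← Finset.sum_product' (s := Finset.univ) (t := Finset.univ)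
      (f := fun i j => if consec g i j then |f i - f j| else 0), hT, Finset.sum_filter]
    refine Finset.sum_congr rfl fun x _ => ?_
    split_ifs with hc
    · have hlt : x.1 < x.2 := hc.2.2.1
      rw [Finset.sum_Ico_sub h (le_of_lt hlt), hfi, hfi, abs_sub_comm, abs_of_nonneg]
      exact sub_nonneg.2 (hmono (le_of_lt hlt))
    · rfl
  have hdis : Set.PairwiseDisjoint (T : Set (Fin (N+1) × Fin (N+1)))
      (fun x => Finset.Ico x.1.1 x.2.1) := by
    rintro ⟨i, j⟩ hx ⟨i', j'⟩ hy hne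
    simp only [hT, Finset.coe_filter, Finset.mem_univ, true_and, Set.mem_ofPred_eq] at hx hy
    rw [Function.onFun, Finset.disjoint_left]
    intro p hp hp'
    simp only [Finset.mem_Ico] at hp hp'
    obtain ⟨hi, hj, hij, hb⟩ := hx
    obtain ⟨hi', hj', hij', hb'⟩ := hy
    apply hne
    have key : ∀ a : Fin (N+1), (g a).isSome = true → g a ≠ none := by
      intro a ha h0; rw [h0] at ha; simp at ha
    have h1 : i = i' := by
      by_contra hcon
      rcases lt_or_gt_of_ne hcon with h1 | h1
      · exact key _ hi' (hb _ h1 (by rw [Fin.lt_def]; omega))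
      · exact key _ hi (hb' _ h1 (by rw [Fin.lt_def]; omega))
    have h2 : j = j' := by
      by_contra hcon
      rcases lt_or_gt_of_ne hcon with h1 | h1
      · exact key _ hj (hb' _ (by rw [Fin.lt_def]; omega) h1)
      · exact key _ hj' (hb _ (by rw [Fin.lt_def]; omega) h1)
    rw [h1, h2]
  rw [e1, ← Finset.sum_biUnion hdis]
  calc _ ≤ ∑ p ∈ Finset.range N, (h (p+1) - h p) := by
        apply Finset.sum_le_sum_of_subset_of_nonneg
        · intro p hp
          simp only [Finset.mem_biUnion, Finset.mem_Ico] at hp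
          obtain ⟨x, _, _, h2⟩ := hp
          have := x.2.2
          simp only [Finset.mem_range]; omega
        · intro p _ _
          exact sub_nonneg.2 (hmono (by omega))
    _ = _ := by
        rw [Finset.sum_range_sub, hfi, hfi]; rfl

/-- main cost lemma -/
lemma cost_bound {N : ℕ} (g : Fin (N+1) → Option ℝ) (κ : Fin (N+1) → ℕ) (hκ : Monotone κ)
    (d : ℕ → ℝ) (hd : Monotone d) {ι : Type*} (s : Finset ι) (δ : ι → ℝ) (lo hi : ι → ℕ)
    (hv : ∀ i v, g i = some v →
      v = d (κ i) + ∑ a ∈ s, δ a * (if lo a ≤ κ i ∧ κ i < hi a then 1 else 0)) 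
    (hd0 : d (κ (Fin.last N)) - d (κ 0) ≤ 1) :
    configCost g ≤ 1 + ∑ a ∈ s, 2 * |δ a| := by
  have ind : ∀ lo : ℕ, Wv g (fun i => if lo ≤ κ i then (1:ℝ) else 0) ≤ 1 := by
    intro lo
    refine (Wv_mono g _ ?_).trans ?_
    · intro i j hij
      have := hκ hij
      show (if lo ≤ κ i then (1:ℝ) else 0) ≤ if lo ≤ κ j then (1:ℝ) else 0
      split_ifs <;> first | omega | norm_num
    · show (if lo ≤ κ _ then (1:ℝ) else 0) - (if lo ≤ κ _ then (1:ℝ) else 0) ≤ 1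
      split_ifs <;> norm_num
  have ind2 : ∀ lo hi : ℕ, Wv g (fun i => if lo ≤ κ i ∧ κ i < hi then (1:ℝ) else 0) ≤ 2 := by
    intro lo hi
    have e : (fun i => if lo ≤ κ i ∧ κ i < hi then (1:ℝ) else 0) =
      (fun i => (if lo ≤ κ i then (1:ℝ) else 0) + 
        (-1) * (if max lo hi ≤ κ i then (1:ℝ) else 0)) := by
      funext i
      by_cases h1 : lo ≤ κ i <;> by_cases h2 : κ i < hi
      · rw [if_pos ⟨h1, h2⟩, if_pos h1, if_neg (by omega)]; norm_num
      · rw [if_neg (by tauto), if_pos h1, if_pos (by omega)]; norm_num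
      · rw [if_neg (by tauto), if_neg h1, if_neg (by omega)]; norm_num
      · rw [if_neg (by tauto), if_neg h1, if_neg (by omega)]; norm_num
    rw [e]
    refine (Wv_add g _ _).trans ?_
    rw [Wv_smul]
    have := ind lo
    have := ind (max lo hi)
    rw [abs_neg, abs_one, one_mul]
    linarith
  have e : configCost g = Wv g (fun i => d (κ i) + 
      ∑ a ∈ s, δ a * (if lo a ≤ κ i ∧ κ i < hi a then 1 else 0)) := by
    unfold configCost Wv
    refine Finset.sum_congr rfl fun i _ => Finset.sum_congr rfl fun j _ => ?_
    by_cases hc : consec g i j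
    · have hc' := hc
      unfold consec at hc'
      rw [if_pos hc, if_pos hc']
      obtain ⟨v, hv1⟩ := Option.isSome_iff_exists.1 hc.1
      obtain ⟨w, hw1⟩ := Option.isSome_iff_exists.1 hc.2.1
      beta_reduce
      rw [← hv i v hv1, ← hv j w hw1, hv1, hw1]
      rfl
    · have hc' := hc
      unfold consec at hc'
      rw [if_neg hc, if_neg hc']
  rw [e]
  refine (Wv_add g _ _).trans (add_le_add ?_ ?_)
  · exact (Wv_mono g _ (hd.comp hκ)).trans hd0
  · refine (Wv_sum g s _).trans (Finset.sum_le_sum fun a _ => ?_)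
    rw [Wv_smul, mul_comm]
    exact mul_le_mul_of_nonneg_right (ind2 _ _) (abs_nonneg _)

/-- `req y l t`: element `t` triggers a request by its level-`l` group. -/
def req (y : ℕ → ℕ) : ℕ → ℕ → Prop
  | 0, _ => True
  | l+1, t => req y l t ∧
      (Nat.count (fun s => req y l s ∧ y s / 2^(l+1) = y t / 2^(l+1)) t) % 2 = 0 ∧
      2 ≤ Nat.count (fun s => req y l s ∧ y s / 2^(l+1) = y t / 2^(l+1)) t

def PP (y : ℕ → ℕ) (l t s : ℕ) : Prop := req y l s ∧ y s / 2^(l+1) = y t / 2^(l+1)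

def rr (y : ℕ → ℕ) (l t : ℕ) : ℕ := Nat.count (PP y l t) t

def tau (y : ℕ → ℕ) (l t : ℕ) : ℕ := Nat.nth (PP y l t) (2 * (rr y l t / 2))

def ee (y : ℕ → ℕ) (l t : ℕ) : ℕ := (y t / 2^l + 1) * 2^l

def stat (k : ℕ) (y : ℕ → ℕ) (i t : ℕ) : ℕ := (ee y i t * (k+1) + i) * 2^(k-i)

def SS (k : ℕ) (y : ℕ → ℕ) : ℕ → ℕ → ℕ → ℕ
  | 0, l, t => 2 * stat k y (l+1) t + rr y l t % 2
  | d+1, l, t => 2 * (if rr y l t < 2 then stat k y (l+1) t else SS k y d (l+1) (tau y l t))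
      + rr y l t % 2

lemma req_succ (y : ℕ → ℕ) (l t : ℕ) :
    req y (l+1) t ↔ req y l t ∧ rr y l t % 2 = 0 ∧ 2 ≤ rr y l t := by
  have e : rr y l t =
      Nat.count (fun s => req y l s ∧ y s / 2^(l+1) = y t / 2^(l+1)) t := by
    unfold rr PP; congr
  rw [req, e]

lemma PP_congr {y : ℕ → ℕ} {l t s : ℕ} (h : y s / 2^(l+1) = y t / 2^(l+1)) :
    PP y l s = PP y l t := by
  funext u; simp [PP, h]

lemma exists_count (p : ℕ → Prop) (c m : ℕ) (h : c < Nat.count p m) :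
    ∃ s < m, p s ∧ Nat.count p s = c := by
  induction m with
  | zero => simp at h
  | succ m ih =>
    rw [Nat.count_succ] at h
    by_cases hc : c < Nat.count p m
    · obtain ⟨s, h1, h2⟩ := ih hc
      exact ⟨s, by omega, h2⟩
    · split_ifs at h with hp
      · exact ⟨m, by omega, hp, by omega⟩
      · omega

lemma tau_spec {y : ℕ → ℕ} {l t : ℕ} (h : req y l t) :
    tau y l t ≤ t ∧ req y l (tau y l t) ∧ y (tau y l t) / 2^(l+1) = y t / 2^(l+1) ∧
      rr y l (tau y l t) = 2 * (rr y l t / 2) := by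
  have hpt : PP y l t t := ⟨h, rfl⟩
  obtain ⟨s, hs, hps, hc⟩ := exists_count (PP y l t) (2 * (rr y l t / 2)) (t+1) (by
    rw [Nat.count_succ, if_pos hpt]; unfold rr; omega)
  have e : tau y l t = s := by
    unfold tau; rw [← hc]; exact Nat.nth_count hps
  rw [e]
  refine ⟨by omega, hps.1, hps.2, ?_⟩
  unfold rr at hc ⊢
  rw [PP_congr hps.2]
  exact hc

lemma tau_req {y : ℕ → ℕ} {l t : ℕ} (h : req y l t) (h2 : 2 ≤ rr y l t) :
    req y (l+1) (tau y l t) := by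
  obtain ⟨_, h3, _, h5⟩ := tau_spec h
  rw [req_succ]
  exact ⟨h3, by omega, by omega⟩

lemma rr_inj {y : ℕ → ℕ} {l t s : ℕ} (ht : req y l t) (hs : req y l s)
    (h : y s / 2^(l+1) = y t / 2^(l+1)) (hr : rr y l s = rr y l t) : s = t := by
  unfold rr at hr
  rw [PP_congr h] at hr
  exact Nat.count_injective (p := PP y l t) ⟨hs, h⟩ ⟨ht, rfl⟩ hr

/-- number of requests halves -/
lemma card_req (y : ℕ → ℕ) (n l : ℕ) :
    2 * ((Finset.range n).filter (req y (l+1))).card ≤ ((Finset.range n).filter (req y l)).card := by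
  set A := (Finset.range n).filter (req y (l+1))
  set B := (Finset.range n).filter (req y l)
  have hAB : A ⊆ B := by
    intro t ht
    simp only [A, B, Finset.mem_filter, req_succ] at ht ⊢
    exact ⟨ht.1, ht.2.1⟩
  have hprev : ∀ t ∈ A, ∃ s ∈ B \ A, y s / 2^(l+1) = y t / 2^(l+1) ∧ rr y l s + 1 = rr y l t := by
    intro t ht
    simp only [A, Finset.mem_filter, req_succ, Finset.mem_range] at ht
    obtain ⟨htn, h1, h2, h3⟩ := ht
    obtain ⟨s, hs, hps, hc⟩ := exists_count (PP y l t) (rr y l t - 1) t (by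
      show _ < rr y l t; omega)
    have hrs : rr y l s = rr y l t - 1 := by
      rw [← hc]; unfold rr; rw [PP_congr hps.2]
    refine ⟨s, ?_, hps.2, by omega⟩
    simp only [A, B, Finset.mem_sdiff, Finset.mem_filter, req_succ, Finset.mem_range]
    refine ⟨⟨by omega, hps.1⟩, ?_⟩
    rintro ⟨_, _, h, _⟩
    omega
  choose! f hf using hprev
  have hcard : A.card ≤ (B \ A).card := by
    apply Finset.card_le_card_of_injOn f (fun t ht => (hf t ht).1)
    intro t ht s hs hts
    have h1 := hf t ht
    have h2 := hf s hs
    rw [← hts] at h2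
    have ht' := hAB ht
    have hs' := hAB hs
    simp only [B, Finset.mem_filter] at ht' hs'
    exact rr_inj hs'.2 ht'.2 (h1.2.1.symm.trans h2.2.1) (by omega)
  have := Finset.card_sdiff_add_card_eq_card hAB
  omega

lemma card_req' (y : ℕ → ℕ) (n l : ℕ) :
    2^l * ((Finset.range n).filter (req y l)).card ≤ n := by
  induction l with
  | zero => 
    have := Finset.card_filter_le (Finset.range n) (req y 0)
    simpa using this
  | succ l ih =>
    have := card_req y n l
    calc _ = 2^l * (2 * ((Finset.range n).filter (req y (l+1))).card) := by ring
      _ ≤ _ := Nat.mul_le_mul_left _ this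
      _ ≤ n := ih

lemma top_rr (y : ℕ → ℕ) (k l t : ℕ) (hl : l + 1 = k) (ht : t < 2^k) (h : req y l t) :
    rr y l t < 2 := by
  have h1 := card_req' y (2^k) l
  have h2 : ((Finset.range (2^k)).filter (req y l)).card ≤ 2 := by
    rw [← hl, pow_succ] at h1
    rw [← hl, pow_succ]
    exact Nat.le_of_mul_le_mul_left h1 (by positivity)
  have h3 : rr y l t + 1 ≤ ((Finset.range (2^k)).filter (req y l)).card := by
    have : rr y l t + 1 = Nat.count (PP y l t) (t+1) := by
      rw [Nat.count_succ, if_pos ⟨h, rfl⟩]; rfl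
    rw [this, Nat.count_eq_card_filter_range]
    apply Finset.card_le_card
    intro s hs
    simp only [Finset.mem_filter, Finset.mem_range] at hs ⊢
    exact ⟨by omega, hs.2.1⟩
  omega

/-- the block lies in a static chunk of higher level -/
lemma SS_form (k j : ℕ) (y : ℕ → ℕ) (hy : ∀ t, y t < 2^(k+j)) (d l t : ℕ) (hd : l + d + 1 = k)
    (h : req y l t) : ∃ i g o, l < i ∧ i ≤ k ∧ g < 2^(k+j-i) ∧ o < 2^(i-l) ∧
      SS k y d l t = ((g+1) * 2^i * (k+1) + i) * 2^(k-l) + o := by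
  have hst : ∀ l t, l + 1 ≤ k → ∃ i g o, l < i ∧ i ≤ k ∧ g < 2^(k+j-i) ∧ o < 2^(i-l) ∧
      2 * stat k y (l+1) t + rr y l t % 2 = ((g+1) * 2^i * (k+1) + i) * 2^(k-l) + o := by
    intro l t hl
    refine ⟨l+1, y t / 2^(l+1), rr y l t % 2, by omega, hl, ?_, ?_, ?_⟩
    · rw [Nat.div_lt_iff_lt_mul (by positivity), ← pow_add]
      convert hy t using 2; omega
    · have : l + 1 - l = 1 := by omega
      rw [this]; omega
    · unfold stat ee
      have : k - l = (k - (l+1)) + 1 := by omega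
      rw [this, pow_succ]; ring
  induction d generalizing l t with
  | zero => rw [SS]; exact hst l t (by omega)
  | succ d ih =>
    rw [SS]
    split_ifs with hr
    · exact hst l t (by omega)
    · obtain ⟨i, g, o, h1, h2, h3, h4, h5⟩ := ih (l+1) (tau y l t) (by omega) (tau_req h (by omega))
      refine ⟨i, g, 2 * o + rr y l t % 2, by omega, h2, h3, ?_, ?_⟩
      · have : i - l = (i - (l+1)) + 1 := by omega
        rw [this, pow_succ]; omega
      · rw [h5]
        have : k - l = (k - (l+1)) + 1 := by omega
        rw [this, pow_succ]; ring

/-- static number of a block -/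
lemma SS_div (k j : ℕ) (y : ℕ → ℕ) (hy : ∀ t, y t < 2^(k+j)) (d l t : ℕ) (hd : l + d + 1 = k)
    (h : req y l t) : ∃ i g, l < i ∧ i ≤ k ∧ g < 2^(k+j-i) ∧ 
      SS k y d l t / 2^(k-l) = (g+1) * 2^i * (k+1) + i := by
  obtain ⟨i, g, o, h1, h2, h3, h4, h5⟩ := SS_form k j y hy d l t hd h
  refine ⟨i, g, h1, h2, h3, ?_⟩
  rw [h5, Nat.add_comm, Nat.add_mul_div_right _ _ (by positivity), Nat.div_eq_of_lt, zero_add]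
  exact lt_of_lt_of_le h4 (Nat.pow_le_pow_right (by norm_num) (by omega))

lemma stat_div (k : ℕ) (y : ℕ → ℕ) (i t : ℕ) :
    stat k y i t / 2^(k-i) = ee y i t * (k+1) + i := by
  unfold stat; rw [Nat.mul_div_cancel _ (by positivity)]

lemma zmod (k a b i i' : ℕ) (hi : i ≤ k) (hi' : i' ≤ k) (h : a * (k+1) + i = b * (k+1) + i') :
    i = i' ∧ a = b := by
  have h1 : (a * (k+1) + i) % (k+1) = i := by
    rw [Nat.mul_comm, Nat.mul_add_mod, Nat.mod_eq_of_lt (by omega)]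
  have h2 : (b * (k+1) + i') % (k+1) = i' := by
    rw [Nat.mul_comm, Nat.mul_add_mod, Nat.mod_eq_of_lt (by omega)]
  have h3 : i = i' := by rw [← h1, h, h2]
  subst h3
  exact ⟨rfl, Nat.eq_of_mul_eq_mul_right (by omega : 0 < k+1) (by omega)⟩

lemma ee_inj {y : ℕ → ℕ} {l s t : ℕ} (h : ee y l s = ee y l t) : y s / 2^l = y t / 2^l := by
  unfold ee at h
  have := Nat.eq_of_mul_eq_mul_right (by positivity : 0 < 2^l) h
  omega

lemma SS_inj (k j : ℕ) (y : ℕ → ℕ) (hy : ∀ t, y t < 2^(k+j)) (d l t s : ℕ) (hd : l + d + 1 = k)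
    (ht : req y l t) (hs : req y l s) (htn : t < 2^k) (hsn : s < 2^k) 
    (h : SS k y d l s = SS k y d l t) : s = t := by
  have hss : ∀ l t s, l + 1 ≤ k → req y l t → req y l s → rr y l t < 2 → rr y l s < 2 → 
      rr y l s % 2 = rr y l t % 2 →
      stat k y (l+1) s = stat k y (l+1) t → s = t := by
    intro l t s hl ht hs htr hsr hr hst
    have h1 := stat_div k y (l+1) s
    rw [hst, stat_div] at h1
    have h2 := (zmod k _ _ _ _ hl hl h1).2
    exact rr_inj ht hs (ee_inj h2.symm) (by omega)
  induction d generalizing l t s with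
  | zero =>
    rw [SS, SS] at h
    exact hss l t s (by omega) ht hs (top_rr y k l t (by omega) htn ht)
      (top_rr y k l s (by omega) hsn hs) (by omega) (by omega)
  | succ d ih =>
    have mixed : ∀ t s, req y l t → 2 ≤ rr y l t →
        stat k y (l+1) s ≠ SS k y d (l+1) (tau y l t) := by
      intro t s ht hr heq
      obtain ⟨i, g, h1, h2, h3, h4⟩ := SS_div k j y hy d (l+1) (tau y l t) (by omega) (tau_req ht hr)
      rw [← heq, stat_div] at h4
      have := (zmod k _ _ _ _ (by omega) h2 h4).1
      omega
    rw [SS, SS] at h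
    split_ifs at h with h1 h2 h2
    · exact hss l t s (by omega) ht hs h2 h1 (by omega) (by omega)
    · exact absurd (by omega) (mixed t s ht (by omega))
    · exact absurd (by omega) (mixed s t hs (by omega))
    · obtain ⟨a1, a2, a3, a4⟩ := tau_spec ht
      obtain ⟨b1, b2, b3, b4⟩ := tau_spec hs
      have := ih (l+1) (tau y l t) (tau y l s) (by omega) (tau_req ht (by omega))
        (tau_req hs (by omega)) (by omega) (by omega) (by omega)
      rw [this] at b3 b4
      exact rr_inj ht hs (b3.symm.trans a3) (by omega)

/-- values attached to levels -/
def vv (j k : ℕ) (y : ℕ → ℕ) (a : ℕ → ℝ) : ℕ → ℕ → ℝ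
  | 0, t => a t
  | l+1, t => (ee y (l+1) t : ℝ) / 2^(k+j)

def dd (j k : ℕ) (p : ℕ) : ℝ := min 1 (((p / 2^k / (k+1) : ℕ) : ℝ) / 2^(k+j))

def inner1 (j k : ℕ) (y : ℕ → ℕ) (a : ℕ → ℝ) (p l : ℕ) : ℝ :=
  ∑ t ∈ (Finset.range (2^k)).filter (req y l),
    (vv j k y a l t - vv j k y a (l+1) t) * (if p / 2^l = SS k y (k-1-l) l t then 1 else 0)

def ff (j k : ℕ) (y : ℕ → ℕ) (a : ℕ → ℝ) (l p : ℕ) : ℝ :=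
  dd j k p + ∑ l' ∈ Finset.Ico l k, inner1 j k y a p l'

/-- if the static level of `p` is at most `l`, no level-`l` block contains `p`. -/
lemma inner1_zero (j k : ℕ) (y : ℕ → ℕ) (hy : ∀ t, y t < 2^(k+j)) (a : ℕ → ℝ) (p l : ℕ)
    (hl : l < k) (hp : ∀ i g, l < i → i ≤ k → g < 2^(k+j-i) → p / 2^k ≠ (g+1) * 2^i * (k+1) + i) :
    inner1 j k y a p l = 0 := by
  unfold inner1
  refine Finset.sum_eq_zero fun t ht => ?_
  rw [if_neg, mul_zero]
  intro h
  obtain ⟨i, g, h1, h2, h3, h4⟩ := SS_div k j y hy (k-1-l) l t (by omega) (Finset.mem_filter.1 ht).2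
  apply hp i g h1 h2 h3
  rw [← h4, ← h, Nat.div_div_eq_div_mul, ← pow_add]
  congr 2; omega

lemma ee_le (k j : ℕ) (y : ℕ → ℕ) (hy : ∀ t, y t < 2^(k+j)) (l t : ℕ) (hl : l ≤ k) :
    ee y l t ≤ 2^(k+j) := by
  unfold ee
  have : y t / 2^l < 2^(k+j-l) := by
    rw [Nat.div_lt_iff_lt_mul (by positivity), ← pow_add]
    convert hy t using 2; omega
  calc _ ≤ 2^(k+j-l) * 2^l := Nat.mul_le_mul_right _ this
    _ = 2^(k+j) := by rw [← pow_add]; congr 1; omega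

lemma ff_spec (j k : ℕ) (y : ℕ → ℕ) (hy : ∀ t, y t < 2^(k+j)) (a : ℕ → ℝ) (d l t p : ℕ)
    (hd : l + d + 1 = k) (h : req y l t) (htn : t < 2^k) (hp : p / 2^l = SS k y d l t) :
    ff j k y a l p = vv j k y a l t := by
  have hstat : ∀ l t p, l + 1 ≤ k → p / 2^(l+1) = stat k y (l+1) t →
      ff j k y a (l+1) p = vv j k y a (l+1) t := by
    intro l t p hl hp
    have hz : p / 2^k = ee y (l+1) t * (k+1) + (l+1) := by
      rw [← stat_div, ← hp, Nat.div_div_eq_div_mul, ← pow_add]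
      congr 2; omega
    unfold ff
    rw [Finset.sum_eq_zero, add_zero]
    · unfold dd
      rw [hz, vv]
      have e1 : (ee y (l+1) t * (k+1) + (l+1)) / (k+1) = ee y (l+1) t + (l+1)/(k+1) := by
        rw [Nat.add_comm, Nat.add_mul_div_right _ _ (by omega), Nat.add_comm]
      rw [e1, Nat.div_eq_of_lt (by omega), Nat.add_zero]
      apply min_eq_right
      rw [div_le_one (by positivity)]
      exact_mod_cast ee_le k j y hy (l+1) t hl
    · intro l' hl'
      rw [Finset.mem_Ico] at hl'
      apply inner1_zero j k y hy a p l' hl'.2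
      intro i g h1 h2 h3 h4
      rw [hz] at h4
      have := (zmod k _ _ _ _ hl h2 h4).1
      omega
  have step : ∀ d l t p, l + d + 1 = k → req y l t → t < 2^k → p / 2^l = SS k y d l t →
      ff j k y a (l+1) p = vv j k y a (l+1) t → ff j k y a l p = vv j k y a l t := by
    intro d l t p hd h htn hp hnext
    have e : ff j k y a l p = ff j k y a (l+1) p + inner1 j k y a p l := by
      unfold ff
      rw [Finset.sum_eq_sum_Ico_succ_bot (by omega : l < k)]
      ring
    rw [e, hnext]
    unfold inner1
    have hdd : k - 1 - l = d := by omega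
    rw [hdd, Finset.sum_eq_single t, if_pos hp]
    · ring
    · intro s hs hst
      rw [if_neg, mul_zero]
      intro h2
      rw [Finset.mem_filter, Finset.mem_range] at hs
      exact hst (SS_inj k j y hy d l t s hd h hs.2 htn hs.1 (h2.symm.trans hp))
    · intro h2
      exact absurd (Finset.mem_filter.2 ⟨Finset.mem_range.2 htn, h⟩) h2
  have half : ∀ p l c b, b < 2 → p / 2^l = 2 * c + b → p / 2^(l+1) = c := by
    intro p l c b hb h
    rw [pow_succ, ← Nat.div_div_eq_div_mul, h]; omega
  induction d generalizing l t with
  | zero =>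
    refine step 0 l t p hd h htn hp ?_
    rw [SS] at hp
    exact hstat l t p (by omega) (half _ _ _ _ (by omega) hp)
  | succ d ih =>
    refine step (d+1) l t p hd h htn hp ?_
    rw [SS] at hp
    have hp' := half _ _ _ _ (by omega) hp
    split_ifs at hp' with hr
    · exact hstat l t p (by omega) hp'
    · obtain ⟨a1, a2, a3, a4⟩ := tau_spec h
      rw [ih (l+1) (tau y l t) (by omega) (tau_req h (by omega)) (by omega) hp']
      simp only [vv, ee, a3]

/-- online-ness -/
lemma req_congr (y y' : ℕ → ℕ) (l t : ℕ) (h : ∀ s ≤ t, y s = y' s) : req y l t ↔ req y' l t := by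
  induction l generalizing t with
  | zero => simp [req]
  | succ l ih =>
    have e : rr y l t = rr y' l t := by
      unfold rr
      rw [Nat.count_eq_card_filter_range, Nat.count_eq_card_filter_range]
      congr 1
      apply Finset.filter_congr
      intro s hs
      rw [Finset.mem_range] at hs
      unfold PP
      rw [ih s (fun u hu => h u (by omega)), h s (by omega), h t le_rfl]
    rw [req_succ, req_succ, e, ih t h]

lemma PP_congr2 (y y' : ℕ → ℕ) (l t s : ℕ) (h : ∀ s ≤ t, y s = y' s) (hs : s ≤ t) :
    PP y l t s ↔ PP y' l t s := by
  unfold PP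
  rw [req_congr y y' l s (fun u hu => h u (by omega)), h s hs, h t le_rfl]

lemma rr_congr (y y' : ℕ → ℕ) (l t : ℕ) (h : ∀ s ≤ t, y s = y' s) : rr y l t = rr y' l t := by
  unfold rr
  rw [Nat.count_eq_card_filter_range, Nat.count_eq_card_filter_range]
  congr 1
  apply Finset.filter_congr
  intro s hs
  rw [Finset.mem_range] at hs
  exact PP_congr2 y y' l t s h (by omega)

lemma tau_congr (y y' : ℕ → ℕ) (l t : ℕ) (h : ∀ s ≤ t, y s = y' s) (hr : req y l t) :
    tau y l t = tau y' l t := by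
  have hr' := (req_congr y y' l t h).1 hr
  obtain ⟨a1, a2, a3, a4⟩ := tau_spec hr
  obtain ⟨b1, b2, b3, b4⟩ := tau_spec hr'
  apply rr_inj (y := y') b2
  · exact (req_congr y y' l _ (fun u hu => h u (by omega))).1 a2
  · rw [b3, ← h _ a1, ← h _ le_rfl, a3]
  · rw [b4, ← rr_congr y y' l _ (fun u hu => h u (by omega)), a4, rr_congr y y' l t h]

lemma SS_congr (k : ℕ) (y y' : ℕ → ℕ) (d l t : ℕ) (h : ∀ s ≤ t, y s = y' s) (hr : req y l t) :
    SS k y d l t = SS k y' d l t := by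
  have hst : stat k y (l+1) t = stat k y' (l+1) t := by
    unfold stat ee; rw [h t le_rfl]
  induction d generalizing l t with
  | zero => rw [SS, SS, hst, rr_congr y y' l t h]
  | succ d ih =>
    rw [SS, SS, hst, rr_congr y y' l t h]
    split_ifs with h2
    · rfl
    · rw [← tau_congr y y' l t h hr]
      rw [← rr_congr y y' l t h] at h2
      have ht := tau_spec hr
      have h' : ∀ s ≤ tau y l t, y s = y' s := fun u hu => h u (by omega)
      rw [ih (l+1) (tau y l t) h' (tau_req hr (by omega)) (by
        unfold stat ee; rw [h' _ le_rfl])]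

lemma vv_diff (j k : ℕ) (y : ℕ → ℕ) (a : ℕ → ℝ) (l t : ℕ)
    (ha : (y t : ℝ) ≤ a t * 2^(k+j) ∧ a t * 2^(k+j) ≤ y t + 1) :
    |vv j k y a l t - vv j k y a (l+1) t| ≤ 2^(l+1) / 2^(k+j) := by
  have he : ∀ l, y t + 1 ≤ ee y l t ∧ ee y l t ≤ y t + 2^l := by
    intro l
    unfold ee
    have h1 := Nat.div_add_mod (y t) (2^l)
    have h2 := Nat.mod_lt (y t) (by positivity : 2^l > 0)
    have h3 : (y t / 2^l + 1) * 2^l = 2^l * (y t / 2^l) + 2^l := by ring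
    rw [h3]; omega
  have hpos : (0:ℝ) < 2^(k+j) := by positivity
  have he' : ∀ l, (y t : ℝ) + 1 ≤ ee y l t ∧ (ee y l t : ℝ) ≤ y t + 2^l := by
    intro l; exact ⟨by exact_mod_cast (he l).1, by exact_mod_cast (he l).2⟩
  have p1 : (1:ℝ) ≤ 2^l := one_le_pow₀ (by norm_num)
  have h2 := he' (l+1)
  rw [pow_succ] at h2
  cases l with
  | zero =>
    rw [vv, vv, abs_le, ← neg_div]
    have e : a t - (ee y (0+1) t : ℝ) / 2^(k+j) = (a t * 2^(k+j) - ee y (0+1) t) / 2^(k+j) := by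
      field_simp
    rw [e]
    constructor
    · gcongr; norm_num at h2 ⊢; linarith [h2.2, ha.1]
    · gcongr; norm_num at h2 ⊢; linarith [h2.1, ha.2]
  | succ l =>
    have h1 := he' (l+1)
    rw [vv, vv, abs_le, ← neg_div, ← sub_div]
    rw [pow_succ (2:ℝ) (l+1)]
    constructor
    · gcongr; linarith
    · gcongr; linarith

def leaf (M : ℕ) (x : ℝ) : ℕ := min ⌊x * M⌋₊ (M - 1)

lemma leaf_lt (M : ℕ) (hM : 0 < M) (x : ℝ) : leaf M x < M := by
  unfold leaf; omega

lemma leaf_spec (M : ℕ) (hM : 0 < M) (x : ℝ) (h0 : 0 ≤ x) (h1 : x ≤ 1) :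
    (leaf M x : ℝ) ≤ x * M ∧ x * M ≤ leaf M x + 1 := by
  have hx : 0 ≤ x * M := by positivity
  have hx1 : x * M ≤ M := by
    have : (0:ℝ) ≤ M := by positivity
    nlinarith
  constructor
  · refine le_trans ?_ (Nat.floor_le hx)
    exact_mod_cast min_le_left _ _
  · unfold leaf
    rcases le_total ⌊x * M⌋₊ (M-1) with h | h
    · rw [min_eq_left h]; exact (Nat.lt_floor_add_one _).le
    · rw [min_eq_right h]
      have : ((M - 1 : ℕ) : ℝ) + 1 = M := by
        have : M - 1 + 1 = M := by omega
        exact_mod_cast this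
      rw [this]; exact hx1

def cells (k j : ℕ) : Finset ℕ :=
  (Finset.Icc 1 k).biUnion fun i => (Finset.range (2^(k+j-i)) ×ˢ Finset.range (2^i)).image
    (fun x => ((x.1+1) * 2^i * (k+1) + i) * 2^k + x.2)

lemma mem_cells (k j p : ℕ) : p ∈ cells k j ↔ ∃ i g o, 1 ≤ i ∧ i ≤ k ∧ g < 2^(k+j-i) ∧ o < 2^i ∧
    p = ((g+1) * 2^i * (k+1) + i) * 2^k + o := by
  unfold cells
  simp only [Finset.mem_biUnion, Finset.mem_Icc, Finset.mem_image, Finset.mem_product,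
    Finset.mem_range, Prod.exists]
  constructor
  · rintro ⟨i, ⟨h1, h2⟩, g, o, ⟨h3, h4⟩, h5⟩
    exact ⟨i, g, o, h1, h2, h3, h4, h5.symm⟩
  · rintro ⟨i, g, o, h1, h2, h3, h4, h5⟩
    exact ⟨i, ⟨h1, h2⟩, g, o, ⟨h3, h4⟩, h5.symm⟩

lemma card_cells (k j : ℕ) : (cells k j).card ≤ k * 2^(k+j) := by
  unfold cells
  refine Finset.card_biUnion_le.trans ?_
  calc _ ≤ ∑ i ∈ Finset.Icc 1 k, 2^(k+j) := by
        refine Finset.sum_le_sum fun i hi => ?_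
        refine Finset.card_image_le.trans ?_
        rw [Finset.mem_Icc] at hi
        rw [Finset.card_product, Finset.card_range, Finset.card_range, ← pow_add]
        exact le_of_eq (by congr 1; omega)
    _ = _ := by simp

lemma cells_pos (k j p : ℕ) (h : p ∈ cells k j) : 0 < p := by
  obtain ⟨i, g, o, h1, h2, h3, h4, rfl⟩ := (mem_cells k j p).1 h
  have : 0 < ((g+1) * 2^i * (k+1) + i) * 2^k := by positivity
  omega

def topKey (k j : ℕ) : ℕ := (2^(k+j) * (k+1) + (k+1)) * 2^k

lemma stat_lt_top (k j i g : ℕ) (h2 : i ≤ k) (h3 : g < 2^(k+j-i)) :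
    (g+1) * 2^i * (k+1) + i < 2^(k+j) * (k+1) + (k+1) := by
  have h5 : (g+1) * 2^i ≤ 2^(k+j) := by
    calc _ ≤ 2^(k+j-i) * 2^i := Nat.mul_le_mul_right _ h3
      _ = 2^(k+j) := by rw [← pow_add]; congr 1; omega
  have := Nat.mul_le_mul_right (k+1) h5
  omega

lemma cells_lt (k j p : ℕ) (h : p ∈ cells k j) : p < topKey k j := by
  obtain ⟨i, g, o, h1, h2, h3, h4, rfl⟩ := (mem_cells k j p).1 h
  have h5 := stat_lt_top k j i g h2 h3
  have h6 : 2^i ≤ 2^k := Nat.pow_le_pow_right (by norm_num) h2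
  unfold topKey
  have h7 := Nat.mul_le_mul_right (2^k) (Nat.succ_le_of_lt h5)
  rw [Nat.succ_mul] at h7
  omega

lemma key_mem (k j : ℕ) (hk : 1 ≤ k) (y : ℕ → ℕ) (hy : ∀ t, y t < 2^(k+j)) (t : ℕ) :
    SS k y (k-1) 0 t ∈ cells k j := by
  obtain ⟨i, g, o, h1, h2, h3, h4, h5⟩ := SS_form k j y hy (k-1) 0 t (by omega) (by simp [req])
  rw [mem_cells]
  exact ⟨i, g, o, h1, h2, h3, by simpa using h4, by simpa using h5⟩

lemma ff_zero (j k : ℕ) (y : ℕ → ℕ) (hy : ∀ t, y t < 2^(k+j)) (a : ℕ → ℝ) :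
    ff j k y a 0 0 = 0 := by
  unfold ff
  rw [Finset.sum_eq_zero]
  · simp [dd]
  · intro l hl
    apply inner1_zero j k y hy a 0 l (Finset.mem_Ico.1 hl).2
    intro i g h1 h2 h3 h4
    rw [Nat.zero_div] at h4
    omega

lemma ff_top (j k : ℕ) (y : ℕ → ℕ) (hy : ∀ t, y t < 2^(k+j)) (a : ℕ → ℝ) :
    ff j k y a 0 (topKey k j) = 1 := by
  have e : topKey k j / 2^k = 2^(k+j) * (k+1) + (k+1) := by
    unfold topKey; rw [Nat.mul_div_cancel _ (by positivity)]
  unfold ff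
  rw [Finset.sum_eq_zero]
  · unfold dd
    have e2 : (2^(k+j) * (k+1) + (k+1)) / (k+1) = 2^(k+j) + 1 := by
      rw [← Nat.succ_mul, Nat.mul_div_cancel _ (by omega)]
    rw [e, e2, add_zero]
    apply min_eq_left
    rw [le_div_iff₀ (by positivity)]
    push_cast; linarith
  · intro l hl
    apply inner1_zero j k y hy a _ l (Finset.mem_Ico.1 hl).2
    intro i g h1 h2 h3 h4
    rw [e] at h4
    have := stat_lt_top k j i g h2 h3
    omega

lemma dd_mono (j k : ℕ) : Monotone (dd j k) := by
  intro p q hpq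
  unfold dd
  apply min_le_min le_rfl
  gcongr

def theStrat (k j : ℕ) (h0 : 0 < (cells k j).card) (L : List ℝ) : Fin (cells k j).card :=
  if h : ∃ i, (cells k j).orderEmbOfFin rfl i =
      SS k (fun s => leaf (2^(k+j)) (L.getD s 0)) (k-1) 0 (L.length - 1) then h.choose
  else ⟨0, h0⟩

lemma theStrat_spec (k j : ℕ) (hk : 1 ≤ k) (h0 : 0 < (cells k j).card) (L : List ℝ) :
    (cells k j).orderEmbOfFin rfl (theStrat k j h0 L) =
      SS k (fun s => leaf (2^(k+j)) (L.getD s 0)) (k-1) 0 (L.length - 1) := by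
  have h : ∃ i, (cells k j).orderEmbOfFin rfl i =
      SS k (fun s => leaf (2^(k+j)) (L.getD s 0)) (k-1) 0 (L.length - 1) := by
    have := key_mem k j hk (fun s => leaf (2^(k+j)) (L.getD s 0))
      (fun t => leaf_lt _ (by positivity) _) (L.length - 1)
    have hr := Finset.range_orderEmbOfFin (cells k j) (rfl : (cells k j).card = _)
    have h2 : SS k (fun s => leaf (2^(k+j)) (L.getD s 0)) (k-1) 0 (L.length - 1) ∈
      Set.range ((cells k j).orderEmbOfFin rfl) := by rw [hr]; exact this
    exact h2
  unfold theStrat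
  rw [dif_pos h]
  exact h.choose_spec

def aext {n : ℕ} (a : Fin n → ℝ) (s : ℕ) : ℝ := if h : s < n then a ⟨s, h⟩ else 0

lemma place_spec (k j : ℕ) (hk : 1 ≤ k) (h0 : 0 < (cells k j).card) (a : Fin (2^k) → ℝ)
    (t : Fin (2^k)) :
    (cells k j).orderEmbOfFin rfl (place (theStrat k j h0) a t) =
      SS k (fun s => leaf (2^(k+j)) (aext a s)) (k-1) 0 t.1 := by
  unfold place
  rw [theStrat_spec k j hk h0]
  have ht := t.2
  have hlen : ((List.ofFn a).take (t.1+1)).length - 1 = t.1 := by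
    rw [List.length_take, List.length_ofFn]; omega
  rw [hlen]
  apply SS_congr
  · intro s hs
    have : ((List.ofFn a).take (t.1+1)).getD s 0 = aext a s := by
      unfold aext
      rw [dif_pos (by omega)]
      rw [List.getD_eq_getElem _ _ (by rw [List.length_take, List.length_ofFn]; omega)]
      simp
    rw [this]
  · simp [req]

lemma block_iff (p l Q : ℕ) : p / 2^l = Q ↔ Q * 2^l ≤ p ∧ p < (Q+1) * 2^l := by
  rw [Nat.div_eq_iff (by positivity)]
  have : 0 < 2^l := by positivity
  have h : (Q+1) * 2^l = Q * 2^l + 2^l := by ring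
  rw [h]
  omega

lemma main_cost (k j : ℕ) (hk : 1 ≤ k) (hj : 2^j ≤ k) (h0 : 0 < (cells k j).card)
    (a : Fin (2^k) → ℝ) (ha : ∀ t, a t ∈ Set.Icc (0:ℝ) 1) :
    configCost (withSentinels a (place (theStrat k j h0) a)) ≤ 5 * k / 2^j := by
  set y : ℕ → ℕ := fun s => leaf (2^(k+j)) (aext a s) with hydef
  have hy : ∀ t, y t < 2^(k+j) := fun t => leaf_lt _ (by positivity) _
  set m := (cells k j).card with hm
  set κ : Fin (m+1+1) → ℕ := fun i =>
    if h1 : i.1 = 0 then 0 else if h2 : i.1 = m+1 then topKey k j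
      else (cells k j).orderEmbOfFin rfl ⟨i.1 - 1, by have := i.2; omega⟩ with hκdef
  have hmem : ∀ i, (cells k j).orderEmbOfFin rfl i ∈ cells k j :=
    fun i => Finset.orderEmbOfFin_mem _ _ _
  have hκ : Monotone κ := by
    intro u v huv
    rw [Fin.le_def] at huv
    simp only [hκdef]
    have hu := u.2
    have hv := v.2
    split_ifs with h1 h2 h3 h4 h5 h6 h7
    all_goals first
      | omega
      | exact Nat.zero_le _
      | exact le_rfl
      | exact (cells_lt k j _ (hmem _)).le
      | (apply ((cells k j).orderEmbOfFin rfl).monotone; rw [Fin.mk_le_mk]; omega)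
  set s : Finset (Σ _ : ℕ, ℕ) :=
    (Finset.Ico 0 k).sigma (fun l => (Finset.range (2^k)).filter (req y l)) with hs
  have hF : ∀ p, ff j k y (aext a) 0 p = dd j k p + ∑ x ∈ s,
      (vv j k y (aext a) x.1 x.2 - vv j k y (aext a) (x.1+1) x.2) *
      (if SS k y (k-1-x.1) x.1 x.2 * 2^x.1 ≤ p ∧ p < (SS k y (k-1-x.1) x.1 x.2 + 1) * 2^x.1
        then 1 else 0) := by
    intro p
    rw [hs, Finset.sum_sigma]
    unfold ff inner1
    simp only [block_iff]
  have hb := cost_bound (withSentinels a (place (theStrat k j h0) a)) κ hκ (dd j k) (dd_mono j k) s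
    (fun x => vv j k y (aext a) x.1 x.2 - vv j k y (aext a) (x.1+1) x.2)
    (fun x => SS k y (k-1-x.1) x.1 x.2 * 2^x.1)
    (fun x => (SS k y (k-1-x.1) x.1 x.2 + 1) * 2^x.1) ?_ ?_
  · refine hb.trans ?_
    have hbd : ∑ x ∈ s, 2 * |vv j k y (aext a) x.1 x.2 - vv j k y (aext a) (x.1+1) x.2| ≤
        k * (4 / 2^j) := by
      rw [hs, Finset.sum_sigma]
      calc _ ≤ ∑ l ∈ Finset.Ico 0 k, (4 / 2^j : ℝ) := by
            refine Finset.sum_le_sum fun l _ => ?_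
            calc _ ≤ ∑ t ∈ (Finset.range (2^k)).filter (req y l), (2 * (2^(l+1) / 2^(k+j)) : ℝ) := by
                  refine Finset.sum_le_sum fun t ht => ?_
                  rw [Finset.mem_filter, Finset.mem_range] at ht
                  refine mul_le_mul_of_nonneg_left (vv_diff j k y (aext a) l t ?_) (by norm_num)
                  have h1 := ha ⟨t, ht.1⟩
                  have h2 : aext a t = a ⟨t, ht.1⟩ := by unfold aext; rw [dif_pos ht.1]
                  have h3 := leaf_spec (2^(k+j)) (by positivity) (aext a t)
                    (by rw [h2]; exact h1.1) (by rw [h2]; exact h1.2)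
                  simpa [hydef] using h3
              _ = ((2^l * ((Finset.range (2^k)).filter (req y l)).card : ℕ) : ℝ) * (4 / 2^(k+j)) := by
                  rw [Finset.sum_const, nsmul_eq_mul]; push_cast; ring
              _ ≤ ((2^k : ℕ) : ℝ) * (4 / 2^(k+j)) := by
                  refine mul_le_mul_of_nonneg_right ?_ (by positivity)
                  exact_mod_cast card_req' y (2^k) l
              _ = 4 / 2^j := by
                  rw [pow_add]; push_cast; field_simp
        _ = _ := by simp
    have h1 : (1:ℝ) ≤ k / 2^j := by
      rw [le_div_iff₀ (by positivity), one_mul]; exact_mod_cast hj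
    calc _ ≤ (k:ℝ) / 2^j + k * (4 / 2^j) := by linarith
      _ = _ := by ring
  · intro i v hv
    rw [← hF]
    unfold withSentinels at hv
    split_ifs at hv with c1 c2 c3
    · have : κ i = 0 := by simp only [hκdef]; rw [dif_pos c1]
      rw [this, ff_zero j k y hy]
      simpa using hv.symm
    · have : κ i = topKey k j := by simp only [hκdef]; rw [dif_neg c1, dif_pos c2]
      rw [this, ff_top j k y hy]
      simpa using hv.symm
    · have hc := c3.choose_spec
      have : κ i = SS k y (k-1) 0 (c3.choose).1 := by
        rw [← place_spec k j hk h0 a]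
        simp only [hκdef]; rw [dif_neg c1, dif_neg c2]
        congr 1
        ext; simp only; omega
      rw [this, ff_spec j k y hy (aext a) (k-1) 0 (c3.choose).1 _ (by omega) (by simp [req])
        (c3.choose).2 (by simp)]
      rw [vv]
      unfold aext
      rw [dif_pos (c3.choose).2]
      simpa using hv.symm
  · have h1 : dd j k (κ (Fin.last (m+1))) ≤ 1 := min_le_left _ _
    have h2 : 0 ≤ dd j k (κ 0) := by
      unfold dd; apply le_min <;> positivity
    linarith

theorem statement4 :
    ∃ C : ℝ, 0 < C ∧
      ∀ k j : ℕ, 1 ≤ k → (2 : ℕ) ^ j ≤ k →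
        ∃ m : ℕ,
          (m : ℝ) ≤ 2 ^ j * 2 ^ k * Real.logb 2 ((2 : ℝ) ^ k) ∧
          ∃ strat : List ℝ → Fin m,
            ∀ a : Fin (2 ^ k) → ℝ, (∀ t, a t ∈ Set.Icc (0 : ℝ) 1) →
              Function.Injective (place strat a) ∧
              configCost (withSentinels a (place strat a)) ≤
                C * Real.logb 2 ((2 : ℝ) ^ k) / 2 ^ j := by
  refine ⟨5, by norm_num, ?_⟩
  intro k j hk hj
  have hlog : Real.logb 2 ((2:ℝ)^k) = k := by
    rw [Real.logb_pow, Real.logb_self_eq_one (by norm_num), mul_one]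
  have h0 : 0 < (cells k j).card :=
    Finset.card_pos.2 ⟨_, key_mem k j hk (fun _ => 0) (fun _ => by positivity) 0⟩
  refine ⟨(cells k j).card, ?_, theStrat k j h0, ?_⟩
  · rw [hlog]
    calc ((cells k j).card : ℝ) ≤ ((k * 2^(k+j) : ℕ) : ℝ) := by exact_mod_cast card_cells k j
      _ = _ := by push_cast; ring
  · intro a ha
    rw [hlog]
    refine ⟨?_, main_cost k j hk hj h0 a ha⟩
    intro s t hst
    have h1 := place_spec k j hk h0 a s
    rw [hst, place_spec k j hk h0 a t] at h1
    exact Fin.ext (SS_inj k j _ (fun t => leaf_lt _ (by positivity) _) (k-1) 0 t.1 s.1 (by omega)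
      (by simp [req]) (by simp [req]) t.2 s.2 h1.symm)
end
end

section
/- There is an absolute constant C such that for every integer n ≥ 2 and every real ε with 3·log₂ n/n ≤ ε ≤ 1, there is a deterministic online algorithm for online sorting with unknown range that uses an array of at most (1+ε)·n cells and is C·(log₂ n)³/ε-competitive. -/
/-!
Online sorting with unknown range: a sequence of `n` arbitrary reals arrives online and a
deterministic algorithm places each element irrevocably into an empty cell of an array of
`m` cells (no sentinels).  The cost of the final configuration is the sum of `|x - y|` over
consecutive non-empty cells, and `OPT = max a - min a`.  An algorithm is `c`-competitive if
its cost is at most `c · OPT` on every input.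

STATEMENT 5: there is an absolute constant `C` such that for every `n ≥ 2` and every `ε`
with `3 log₂ n / n ≤ ε ≤ 1` there is a deterministic online algorithm for unknown range
using at most `(1+ε) n` cells that is `C (log₂ n)³ / ε`-competitive.
-/

noncomputable section
attribute [local instance] Classical.propDecidable

/-- The final configuration of an array of `m` cells (no sentinels), when element `a t`
has been placed in cell `pl t`. -/
def config {n m : ℕ} (a : Fin n → ℝ) (pl : Fin n → Fin m) : Fin m → Option ℝ :=
  fun i => if h : ∃ t, pl t = i then some (a h.choose) else none

/-- Online dyadic allocator with `2^d` labels: `f` maps used cells to labels, `k` cells used. -/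
def Alloc : ℕ → ℕ → (ℕ → Option ℕ) → Prop
  | 0, k, f => ∀ c l, f c = some l → c < k
  | d + 1, k, f => ∃ (k' : ℕ) (f' : ℕ → Option ℕ) (F : Finset ℕ), Alloc d k' f' ∧
      (∀ c l, f c = some l → f' (c / 2) = some (l / 2)) ∧
      (∀ b ∈ F, f (2 * b + 1) = none ∧ ∃ l, l < 2 ^ d ∧ f' b = some l) ∧
      (∀ b ∈ F, ∀ b' ∈ F, f' b = f' b' → b = b') ∧
      k + F.card = 2 * k'

theorem alloc_empty (d : ℕ) : Alloc d 0 (fun _ => none) := by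
  induction d with
  | zero => intro c l h; simp at h
  | succ d ih => exact ⟨0, fun _ => none, ∅, ih, by simp, by simp, by simp, by simp⟩

theorem alloc_step (d : ℕ) : ∀ (k : ℕ) (f : ℕ → Option ℕ) (l : ℕ), Alloc d k f → l < 2 ^ d →
    ∃ c, f c = none ∧ Alloc d (k + 1) (Function.update f c (some l)) := by
  induction d with
  | zero =>
    intro k f l h hl
    refine ⟨k, ?_, ?_⟩
    · by_contra hne
      obtain ⟨x, hx⟩ := Option.ne_none_iff_exists'.mp hne
      exact absurd (h k x hx) (lt_irrefl _)
    · intro c l' hc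
      by_cases hck : c = k
      · omega
      · rw [Function.update_of_ne hck] at hc
        have := h c l' hc
        omega
  | succ d ih =>
    rintro k f l ⟨k', f', F, hA, h1, h2, h3, h4⟩ hl
    have hl2 : l / 2 < 2 ^ d := by rw [pow_succ] at hl; omega
    by_cases hb : ∃ b ∈ F, f' b = some (l / 2)
    · obtain ⟨b, hbF, hb⟩ := hb
      refine ⟨2 * b + 1, (h2 b hbF).1, k', f', F.erase b, hA, ?_, ?_, ?_, ?_⟩
      · intro c l' hc
        by_cases hcb : c = 2 * b + 1
        · subst hcb
          rw [Function.update_self] at hc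
          have : (2 * b + 1) / 2 = b := by omega
          rw [this, hb]
          simp at hc
          rw [hc]
        · rw [Function.update_of_ne hcb] at hc
          exact h1 c l' hc
      · intro b' hb'
        rw [Finset.mem_erase] at hb'
        refine ⟨?_, (h2 b' hb'.2).2⟩
        rw [Function.update_of_ne (by have := hb'.1; omega)]
        exact (h2 b' hb'.2).1
      · intro b1 hb1 b2 hb2
        exact h3 b1 (Finset.mem_of_mem_erase hb1) b2 (Finset.mem_of_mem_erase hb2)
      · have := Finset.card_erase_add_one hbF
        omega
    · push Not at hb
      obtain ⟨b, hbn, hA'⟩ := ih k' f' (l / 2) hA hl2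
      have hnone : ∀ c, c / 2 = b → f c = none := by
        intro c hc
        by_contra hne
        obtain ⟨x, hx⟩ := Option.ne_none_iff_exists'.mp hne
        have := h1 c x hx
        rw [hc, hbn] at this
        simp at this
      have hbF : b ∉ F := by
        intro hbF
        obtain ⟨_, x, _, hx⟩ := h2 b hbF
        rw [hbn] at hx
        simp at hx
      refine ⟨2 * b, hnone _ (by omega), k' + 1, _, insert b F, hA', ?_, ?_, ?_, ?_⟩
      · intro c l' hc
        by_cases hcb : c = 2 * b
        · subst hcb
          rw [Function.update_self] at hc
          have : (2 * b) / 2 = b := by omega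
          rw [this, Function.update_self]
          simp at hc
          rw [hc]
        · rw [Function.update_of_ne hcb] at hc
          have h := h1 c l' hc
          rw [Function.update_of_ne, h]
          intro hcc
          rw [hnone c hcc] at hc
          simp at hc
      · intro b' hb'
        rw [Function.update_of_ne (by omega)]
        by_cases hbb : b' = b
        · subst hbb
          exact ⟨hnone _ (by omega), l / 2, hl2, by rw [Function.update_self]⟩
        · have hb'F : b' ∈ F := by
            rcases Finset.mem_insert.mp hb' with h | h
            · exact absurd h hbb
            · exact h
          rw [Function.update_of_ne hbb]
          exact h2 b' hb'F
      · intro b1 hb1 b2 hb2 he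
        rcases Finset.mem_insert.mp hb1 with e1 | e1 <;> rcases Finset.mem_insert.mp hb2 with e2 | e2
        · rw [e1, e2]
        · exfalso
          subst e1
          have hne : b2 ≠ b1 := fun h => hbF (h ▸ e2)
          rw [Function.update_self, Function.update_of_ne hne] at he
          exact hb b2 e2 he.symm
        · exfalso
          subst e2
          have hne : b1 ≠ b2 := fun h => hbF (h ▸ e1)
          rw [Function.update_self, Function.update_of_ne hne] at he
          exact hb b1 e1 he
        · have hne1 : b1 ≠ b := fun h => hbF (h ▸ e1)
          have hne2 : b2 ≠ b := fun h => hbF (h ▸ e2)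
          rw [Function.update_of_ne hne1, Function.update_of_ne hne2] at he
          exact h3 b1 e1 b2 e2 he
      · rw [Finset.card_insert_of_notMem hbF]
        omega

theorem alloc_bound (d : ℕ) : ∀ (k : ℕ) (f : ℕ → Option ℕ), Alloc d k f →
    ∀ c l, f c = some l → c < k + d * 2 ^ d := by
  induction d with
  | zero => intro k f h c l hc; have := h c l hc; omega
  | succ d ih =>
    rintro k f ⟨k', f', F, hA, h1, h2, h3, h4⟩ c l hc
    have hb := ih k' f' hA _ _ (h1 c l hc)
    have hF : F.card ≤ 2 ^ d := by
      have : F.card ≤ (Finset.range (2 ^ d)).card := by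
        apply Finset.card_le_card_of_injOn (fun b => (f' b).getD 0)
        · intro b hb
          obtain ⟨_, x, hx, hx'⟩ := h2 b hb
          simp [hx', hx]
        · intro b hb b' hb' he
          obtain ⟨_, x, hx, hx'⟩ := h2 b hb
          obtain ⟨_, y, hy, hy'⟩ := h2 b' hb'
          apply h3 b hb b' hb'
          simp [hx', hy'] at he
          rw [hx', hy', he]
      simpa using this
    have e : (d + 1) * 2 ^ (d + 1) = 2 * (d * 2 ^ d) + 2 * 2 ^ d := by ring
    omega

theorem alloc_cons (d : ℕ) : ∀ (k : ℕ) (f : ℕ → Option ℕ), Alloc d k f →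
    ∀ c c' l l', f c = some l → f c' = some l' → ∀ j ≤ d, c / 2 ^ j = c' / 2 ^ j →
      l / 2 ^ j = l' / 2 ^ j := by
  have h0 : ∀ (f : ℕ → Option ℕ) (c c' l l' : ℕ), f c = some l → f c' = some l' →
      c / 2 ^ 0 = c' / 2 ^ 0 → l / 2 ^ 0 = l' / 2 ^ 0 := by
    intro f c c' l l' hc hc' he
    simp at he
    subst he
    rw [hc] at hc'
    simp at hc'
    rw [hc']
  induction d with
  | zero =>
    intro k f h c c' l l' hc hc' j hj he
    obtain rfl : j = 0 := by omega
    exact h0 f c c' l l' hc hc' he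
  | succ d ih =>
    rintro k f ⟨k', f', F, hA, h1, h2, h3, h4⟩ c c' l l' hc hc' j hj he
    rcases j with _ | j
    · exact h0 f c c' l l' hc hc' he
    · have := ih k' f' hA _ _ _ _ (h1 c l hc) (h1 c' l' hc') j (by omega)
        (by rw [Nat.div_div_eq_div_mul, Nat.div_div_eq_div_mul, ← pow_succ', he])
      rwa [Nat.div_div_eq_div_mul, Nat.div_div_eq_div_mul, ← pow_succ'] at this

/-- Boundary weight inside an epoch. -/
def wt (d : ℕ) (w : ℝ) (p : ℕ) : ℝ :=
  ∑ j ∈ Finset.range (d + 1), if 2 ^ j ∣ p then 2 ^ (j + 1) * w else 0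

theorem wt_nonneg (d : ℕ) (w : ℝ) (hw : 0 ≤ w) (p : ℕ) : 0 ≤ wt d w p := by
  unfold wt
  apply Finset.sum_nonneg
  intro j _
  split_ifs
  · positivity
  · exact le_rfl

theorem wt_ge (d : ℕ) (w : ℝ) (hw : 0 ≤ w) (p j : ℕ) (hj : j ≤ d) (hp : 2 ^ j ∣ p) :
    2 ^ (j + 1) * w ≤ wt d w p := by
  unfold wt
  have := Finset.single_le_sum (s := Finset.range (d + 1))
    (f := fun j => if 2 ^ j ∣ p then 2 ^ (j + 1) * w else 0) (a := j) ?_ (by simp; omega)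
  · simpa [hp] using this
  · intro i _
    split_ifs
    · positivity
    · exact le_rfl

theorem card_dvd (M s : ℕ) :
    ((Finset.range M).filter (fun p => s ∣ p)).card * s ≤ M + s := by
  have : ((Finset.range M).filter (fun p => s ∣ p)).card ≤ (Finset.range (M / s + 1)).card := by
    apply Finset.card_le_card_of_injOn (fun p => p / s)
    · intro p hp
      simp at hp
      simp
      have := Nat.div_le_div_right (c := s) hp.1.le
      omega
    · intro p hp p' hp' he
      simp at hp hp'
      exact (Nat.div_left_inj hp.2 hp'.2).mp he
  rw [Finset.card_range] at this
  calc _ ≤ (M / s + 1) * s := Nat.mul_le_mul_right _ this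
    _ ≤ _ := by rw [add_mul]; have := Nat.div_mul_le_self M s; omega

theorem wt_sum (d : ℕ) (w : ℝ) (hw : 0 ≤ w) (M : ℕ) :
    ∑ p ∈ Finset.range M, wt d w p ≤ (d + 1) * (2 * w * (M + 2 ^ d)) := by
  unfold wt
  rw [Finset.sum_comm]
  have : ∀ j ∈ Finset.range (d + 1),
      (∑ p ∈ Finset.range M, if 2 ^ j ∣ p then 2 ^ (j + 1) * w else 0) ≤
        2 * w * (M + 2 ^ d) := by
    intro j hj
    rw [← Finset.sum_filter, Finset.sum_const, nsmul_eq_mul]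
    have h := card_dvd M (2 ^ j)
    have h' : (((Finset.range M).filter (fun p => 2 ^ j ∣ p)).card : ℝ) * 2 ^ j ≤ M + 2 ^ j := by
      exact_mod_cast h
    have h2 : (2 : ℝ) ^ j ≤ 2 ^ d := pow_le_pow_right₀ (by norm_num) (by simp at hj; omega)
    calc _ = 2 * w * ((((Finset.range M).filter (fun p => 2 ^ j ∣ p)).card : ℝ) * 2 ^ j) := by
          rw [pow_succ]; ring
      _ ≤ _ := by
          apply mul_le_mul_of_nonneg_left _ (by positivity)
          linarith
  calc _ ≤ ∑ j ∈ Finset.range (d + 1), 2 * w * (M + 2 ^ d) := Finset.sum_le_sum this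
    _ = _ := by simp

theorem label_diff (lo w x y : ℝ) (hw : 0 < w) (hx : lo ≤ x) (hy : lo ≤ y) (j : ℕ)
    (h : ⌊(x - lo) / w⌋₊ / 2 ^ j = ⌊(y - lo) / w⌋₊ / 2 ^ j) : |x - y| ≤ 2 ^ j * w := by
  have key : ∀ x y : ℝ, lo ≤ x → lo ≤ y →
      ⌊(x - lo) / w⌋₊ / 2 ^ j = ⌊(y - lo) / w⌋₊ / 2 ^ j → x - y ≤ 2 ^ j * w := by
    intro x y hx hy h
    set u := ⌊(x - lo) / w⌋₊
    set v := ⌊(y - lo) / w⌋₊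
    have hu : (x - lo) / w < u + 1 := Nat.lt_floor_add_one _
    have hv : (v : ℝ) ≤ (y - lo) / w := Nat.floor_le (div_nonneg (by linarith) hw.le)
    have huv : u + 1 ≤ v + 2 ^ j := by
      have h1 := Nat.div_add_mod u (2 ^ j)
      have h2 := Nat.div_add_mod v (2 ^ j)
      have h3 := Nat.mod_lt u (y := 2 ^ j) (by positivity)
      rw [h] at h1
      omega
    have huv' : (u : ℝ) + 1 ≤ v + 2 ^ j := by exact_mod_cast huv
    rw [div_lt_iff₀ hw] at hu
    rw [le_div_iff₀ hw] at hv
    nlinarith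
  rw [abs_le]
  have h1 := key x y hx hy h
  have h2 := key y x hy hx h.symm
  constructor <;> linarith

/-- State invariant of the online algorithm during an epoch. -/
structure Ep (ε : ℝ) (D : ℕ) (g : ℕ → Option ℝ) (o L k d : ℕ) (mn R a b : ℝ)
    (f : ℕ → Option ℕ) (W : ℕ → ℝ) : Prop where
  R0 : 0 ≤ R
  amn : a ≤ mn
  mnb : mn + R ≤ b
  loa : mn - R ≤ a
  bhi : b ≤ mn + 2 * R
  rng : ∀ c x, g c = some x → a ≤ x ∧ x ≤ b
  atta : ∃ c, g c = some a
  attb : ∃ c, g c = some b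
  al : Alloc d k f
  lab : ∀ c x, g (o + c) = some x → f c = some ⌊(x - (mn - R)) / (3 * R / 2 ^ d)⌋₊
  W0 : ∀ p, 0 ≤ W p
  pair : ∀ c c' x y, c < c' → c' < o → g c = some x → g c' = some y →
    |x - y| ≤ ∑ p ∈ Finset.Ioc c c', W p
  sum : ∑ p ∈ Finset.range o, W p ≤ 24 * (D + 1) ^ 2 / ε * (((D + 1) + d) * R)
  oL : L ≤ o
  space : (o : ℝ) + d * 2 ^ d ≤ (1 + ε) * L
  kb : ε * k ≤ (d + 1) * 2 ^ (d + 1) + 1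

theorem ep_close {ε : ℝ} {D : ℕ} {g : ℕ → Option ℝ} {o L k d : ℕ} {mn R a b : ℝ}
    {f : ℕ → Option ℕ} {W : ℕ → ℝ} (h : Ep ε D g o L k d mn R a b f W)
    (hε : 0 < ε) (hε1 : ε ≤ 1) (n : ℕ) (hn : 1 ≤ n) (hD : D = Nat.log 2 n) (hL : L ≤ n) :
    d ≤ D ∧ (∀ c x, g c = some x → c < o + k + d * 2 ^ d) ∧
    ((o + k + d * 2 ^ d : ℕ) : ℝ) ≤ (1 + ε) * (L + k : ℕ) ∧
    ∃ W' : ℕ → ℝ, (∀ p, 0 ≤ W' p) ∧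
      (∀ c c' x y, c < c' → g c = some x → g c' = some y →
        |x - y| ≤ ∑ p ∈ Finset.Ioc c c', W' p) ∧
      ∑ p ∈ Finset.range (o + k + d * 2 ^ d), W' p ≤
        24 * (D + 1) ^ 2 / ε * (((D + 1) + (d + 1)) * R) := by
  have hR0 := h.R0
  have hw0 : 0 ≤ 3 * R / 2 ^ d := by positivity
  have hdD : d ≤ D := by
    rcases Nat.eq_zero_or_pos d with h0 | h0
    · omega
    · have h1 : (d : ℝ) * 2 ^ d ≤ ε * L := by
        have := h.space
        have : (L : ℝ) ≤ o := by exact_mod_cast h.oL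
        nlinarith
      have h2 : (d : ℝ) * 2 ^ d ≤ n := by
        have : (L : ℝ) ≤ n := by exact_mod_cast hL
        have : (0 : ℝ) ≤ L := by positivity
        nlinarith
      have h3 : d * 2 ^ d ≤ n := by exact_mod_cast h2
      rw [hD]
      apply Nat.le_log_of_pow_le (by norm_num)
      calc 2 ^ d = 1 * 2 ^ d := by ring
        _ ≤ d * 2 ^ d := Nat.mul_le_mul_right _ h0
        _ ≤ n := h3
  have hrng : ∀ c x, g c = some x → mn - R ≤ x ∧ x ≤ mn + 2 * R := by
    intro c x hc
    have := h.rng c x hc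
    have := h.loa
    have := h.bhi
    constructor <;> linarith
  have hfull : 2 ^ d * (3 * R / 2 ^ d) = 3 * R := by field_simp
  refine ⟨hdD, ?_, ?_, fun p => if p < o then W p else wt d (3 * R / 2 ^ d) (p - o), ?_, ?_, ?_⟩
  · intro c x hc
    by_cases hco : c < o
    · omega
    · obtain ⟨r, rfl⟩ : ∃ r, c = o + r := ⟨c - o, by omega⟩
      have := alloc_bound d k f h.al r _ (h.lab r x hc)
      omega
  · have h1 := h.space
    have : (0 : ℝ) ≤ k := by positivity
    push_cast
    nlinarith
  · intro p
    dsimp only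
    split_ifs
    · exact h.W0 p
    · exact wt_nonneg _ _ hw0 _
  · intro c c' x y hcc hx hy
    have hnn : ∀ p ∈ Finset.Ioc c c',
        0 ≤ (if p < o then W p else wt d (3 * R / 2 ^ d) (p - o)) := by
      intro p _
      split_ifs
      · exact h.W0 p
      · exact wt_nonneg _ _ hw0 _
    have hxr := hrng c x hx
    have hyr := hrng c' y hy
    have h3R : |x - y| ≤ 3 * R := by
      rw [abs_le]; constructor <;> linarith
    by_cases hc'o : c' < o
    · refine (h.pair c c' x y hcc hc'o hx hy).trans (le_of_eq ?_)
      apply Finset.sum_congr rfl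
      intro p hp
      rw [Finset.mem_Ioc] at hp
      dsimp only
      rw [if_pos (by omega)]
    · obtain ⟨r', rfl⟩ : ∃ r, c' = o + r := ⟨c' - o, by omega⟩
      suffices hs : ∃ r j, j ≤ d ∧ 2 ^ j ∣ r ∧ c < o + r ∧ r ≤ r' ∧
          |x - y| ≤ 2 ^ (j + 1) * (3 * R / 2 ^ d) by
        obtain ⟨r, j, hj, hdvd, h1, h2, h3⟩ := hs
        have hsl := Finset.single_le_sum hnn (a := o + r) (by rw [Finset.mem_Ioc]; omega)
        refine h3.trans ((wt_ge d _ hw0 r j hj hdvd).trans ?_)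
        have : ¬ (o + r < o) := by omega
        simpa [this] using hsl
      have hbig : |x - y| ≤ 2 ^ (d + 1) * (3 * R / 2 ^ d) := by
        rw [pow_succ, mul_comm (2 ^ d) 2, mul_assoc, hfull]; linarith
      by_cases hco : c < o
      · exact ⟨0, d, le_rfl, dvd_zero _, by omega, by omega, hbig⟩
      · obtain ⟨r, rfl⟩ : ∃ r, c = o + r := ⟨c - o, by omega⟩
        have hrr : r < r' := by omega
        have hmul : ∀ j, r / 2 ^ j ≠ r' / 2 ^ j →
            2 ^ j ∣ r' / 2 ^ j * 2 ^ j ∧ o + r < o + r' / 2 ^ j * 2 ^ j ∧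
              r' / 2 ^ j * 2 ^ j ≤ r' := by
          intro j hj
          refine ⟨Dvd.intro_left _ rfl, ?_, Nat.div_mul_le_self _ _⟩
          have h1 : r / 2 ^ j ≤ r' / 2 ^ j := Nat.div_le_div_right hrr.le
          have h2 : r / 2 ^ j < r' / 2 ^ j := lt_of_le_of_ne h1 hj
          have h3 : r < r' / 2 ^ j * 2 ^ j := (Nat.div_lt_iff_lt_mul (by positivity)).mp h2
          omega
        by_cases hd : r / 2 ^ d = r' / 2 ^ d
        · have hex : ∃ j, r / 2 ^ j = r' / 2 ^ j := ⟨d, hd⟩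
          have hfd : Nat.find hex ≤ d := Nat.find_le hd
          have hsp := Nat.find_spec hex
          rcases hj : Nat.find hex with _ | j
          · rw [hj] at hsp
            simp at hsp
            omega
          · have hne : r / 2 ^ j ≠ r' / 2 ^ j := Nat.find_min hex (by omega)
            obtain ⟨m1, m2, m3⟩ := hmul j hne
            refine ⟨_, j, by omega, m1, m2, m3, ?_⟩
            rw [hj] at hsp
            have hlab := alloc_cons d k f h.al r r' _ _ (h.lab r x hx) (h.lab r' y hy) (j + 1)
              (by omega) hsp
            rcases hR0.eq_or_lt with hR | hR
            · rw [← hR] at h3R ⊢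
              simpa using h3R
            · exact label_diff (mn - R) _ x y (by positivity) hxr.1 hyr.1 (j + 1) hlab
        · obtain ⟨m1, m2, m3⟩ := hmul d hd
          exact ⟨_, d, le_rfl, m1, m2, m3, hbig⟩
  · rw [add_assoc, Finset.sum_range_add]
    have e1 : ∑ p ∈ Finset.range o, (if p < o then W p else wt d (3 * R / 2 ^ d) (p - o)) =
        ∑ p ∈ Finset.range o, W p := by
      apply Finset.sum_congr rfl
      intro p hp
      rw [Finset.mem_range] at hp
      rw [if_pos hp]
    have e2 : ∑ p ∈ Finset.range (k + d * 2 ^ d),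
        (if o + p < o then W (o + p) else wt d (3 * R / 2 ^ d) (o + p - o)) =
        ∑ p ∈ Finset.range (k + d * 2 ^ d), wt d (3 * R / 2 ^ d) p := by
      apply Finset.sum_congr rfl
      intro p hp
      rw [if_neg (by omega), Nat.add_sub_cancel_left]
    rw [e1, e2]
    have hs1 := h.sum
    have hs2 := wt_sum d (3 * R / 2 ^ d) hw0 (k + d * 2 ^ d)
    have hkb := h.kb
    have hp1 : (1 : ℝ) ≤ 2 ^ d := one_le_pow₀ (by norm_num)
    have hM : ε * ((k + d * 2 ^ d : ℕ) + 2 ^ d) ≤ 4 * (d + 1) * 2 ^ d := by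
      push_cast
      have hd0 : (0 : ℝ) ≤ d := by positivity
      have : ε * (d * 2 ^ d + 2 ^ d) ≤ 1 * (d * 2 ^ d + 2 ^ d) :=
        mul_le_mul_of_nonneg_right hε1 (by positivity)
      rw [pow_succ] at hkb
      nlinarith [mul_nonneg hd0 (by positivity : (0 : ℝ) ≤ 2 ^ d)]
    have hM' : (((k + d * 2 ^ d : ℕ) : ℝ) + 2 ^ d) ≤ 4 * (d + 1) * 2 ^ d / ε := by
      rw [le_div_iff₀ hε]; linarith
    have hs3 : (d + 1) * (2 * (3 * R / 2 ^ d) * (((k + d * 2 ^ d : ℕ) : ℝ) + 2 ^ d)) ≤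
        24 * (d + 1) ^ 2 / ε * R := by
      calc _ ≤ (d + 1) * (2 * (3 * R / 2 ^ d) * (4 * (d + 1) * 2 ^ d / ε)) := by gcongr
        _ = _ := by field_simp; ring
    have hs4 : 24 * ((d : ℝ) + 1) ^ 2 / ε * R ≤ 24 * ((D : ℝ) + 1) ^ 2 / ε * R := by
      have : (d : ℝ) ≤ D := by exact_mod_cast hdD
      gcongr
    have : 24 * ((D : ℝ) + 1) ^ 2 / ε * (((D + 1) + (d + 1)) * R) =
      24 * ((D : ℝ) + 1) ^ 2 / ε * (((D + 1) + d) * R) + 24 * ((D : ℝ) + 1) ^ 2 / ε * R := by ring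
    rw [this]
    linarith

theorem label_lt (lo R x : ℝ) (d : ℕ) (hR : 0 ≤ R) (h : x < lo + 3 * R ∨ R = 0) :
    ⌊(x - lo) / (3 * R / 2 ^ d)⌋₊ < 2 ^ d := by
  rcases hR.eq_or_lt with h0 | h0
  · rw [← h0]; simp
  · have hx : x < lo + 3 * R := by
      rcases h with h | h
      · exact h
      · linarith
    rw [Nat.floor_lt' (by positivity), div_lt_iff₀ (by positivity)]
    push_cast
    have : (2 : ℝ) ^ d * (3 * R / 2 ^ d) = 3 * R := by field_simp
    rw [this]; linarith

/-- Start a new epoch. -/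
theorem ep_start {ε : ℝ} {D : ℕ} {g : ℕ → Option ℝ} {o L d : ℕ} {mn R a b : ℝ}
    {W : ℕ → ℝ} (x : ℝ) (hε1 : ε ≤ 1)
    (R0 : 0 ≤ R) (amn : a ≤ mn) (mnb : mn + R ≤ b) (loa : mn - R ≤ a) (bhi : b ≤ mn + 2 * R)
    (rng : ∀ c x, g c = some x → a ≤ x ∧ x ≤ b) (hxa : a ≤ x) (hxb : x ≤ b)
    (hx : x < mn + 2 * R ∨ R = 0)
    (atta : a = x ∨ ∃ c, g c = some a) (attb : b = x ∨ ∃ c, g c = some b)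
    (hcell : ∀ c x, g c = some x → c < o)
    (W0 : ∀ p, 0 ≤ W p)
    (pair : ∀ c c' x y, c < c' → g c = some x → g c' = some y →
      |x - y| ≤ ∑ p ∈ Finset.Ioc c c', W p)
    (sum : ∑ p ∈ Finset.range o, W p ≤ 24 * (D + 1) ^ 2 / ε * (((D + 1) + d) * R))
    (oL : L ≤ o) (space : (o : ℝ) + d * 2 ^ d ≤ (1 + ε) * L) :
    ∃ c f, g c = none ∧ Ep ε D (Function.update g c (some x)) o L 1 d mn R a b f W := by
  obtain ⟨c, -, hA⟩ := alloc_step d 0 (fun _ => none) ⌊(x - (mn - R)) / (3 * R / 2 ^ d)⌋₊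
    (alloc_empty d) (label_lt _ _ _ _ R0 (by rcases hx with h | h; left; linarith; right; exact h))
  have hgc : ∀ r, g (o + r) = none := by
    intro r
    by_contra hne
    obtain ⟨y, hy⟩ := Option.ne_none_iff_exists'.mp hne
    have := hcell _ _ hy
    omega
  have hup : ∀ y, (∃ c, g c = some y) → ∃ c', Function.update g (o + c) (some x) c' = some y := by
    rintro y ⟨c', hc'⟩
    refine ⟨c', ?_⟩
    rw [Function.update_of_ne, hc']
    have := hcell _ _ hc'
    omega
  refine ⟨o + c, _, hgc c, ⟨R0, amn, mnb, loa, bhi, ?_, ?_, ?_, hA, ?_, W0, ?_, sum, oL, space, ?_⟩⟩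
  · intro c' y hy
    by_cases hcc : c' = o + c
    · subst hcc
      rw [Function.update_self] at hy
      simp at hy
      subst hy
      exact ⟨hxa, hxb⟩
    · rw [Function.update_of_ne hcc] at hy
      exact rng _ _ hy
  · rcases atta with h | h
    · exact ⟨o + c, by rw [Function.update_self, h]⟩
    · exact hup _ h
  · rcases attb with h | h
    · exact ⟨o + c, by rw [Function.update_self, h]⟩
    · exact hup _ h
  · intro c' y hy
    by_cases hcc : c' = c
    · subst hcc
      rw [Function.update_self] at hy
      simp at hy
      subst hy
      rw [Function.update_self]
    · rw [Function.update_of_ne (by omega), hgc] at hy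
      simp at hy
  · intro c1 c2 y z h12 h2 hy hz
    rw [Function.update_of_ne (by omega)] at hy hz
    exact pair c1 c2 y z h12 hy hz
  · have : (1 : ℝ) ≤ (d + 1) * 2 ^ (d + 1) + 1 := by
      have : (0 : ℝ) ≤ (d + 1) * 2 ^ (d + 1) := by positivity
      linarith
    push_cast
    linarith

/-- Invariant after `len` elements. -/
def InvS (ε : ℝ) (D : ℕ) (g : ℕ → Option ℝ) (len : ℕ) : Prop :=
  (len = 0 ∧ g = fun _ => none) ∨
  ∃ o L k d mn R a b f W, Ep ε D g o L k d mn R a b f W ∧ L + k = len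

theorem inv_step {ε : ℝ} {D : ℕ} {g : ℕ → Option ℝ} {len : ℕ} (h : InvS ε D g len)
    (hε : 0 < ε) (hε1 : ε ≤ 1) (n : ℕ) (hn : 1 ≤ n) (hD : D = Nat.log 2 n) (hlen : len ≤ n)
    (x : ℝ) : ∃ c, g c = none ∧ InvS ε D (Function.update g c (some x)) (len + 1) := by
  rcases h with ⟨rfl, rfl⟩ | ⟨o, L, k, d, mn, R, a, b, f, W, h, rfl⟩
  · obtain ⟨c, f, hc, hE⟩ := ep_start (ε := ε) (D := D) (g := fun _ => none) (o := 0) (L := 0)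
      (d := 0) (mn := x) (R := 0) (a := x) (b := x) (W := fun _ => 0) x hε1 le_rfl le_rfl (by simp)
      (by simp) (by simp) (by simp) le_rfl le_rfl (Or.inr rfl) (Or.inl rfl) (Or.inl rfl)
      (by simp) (by simp) (by simp) (by simp) le_rfl (by simp)
    exact ⟨c, hc, Or.inr ⟨0, 0, 1, 0, x, 0, x, x, f, _, hE, rfl⟩⟩
  · obtain ⟨hdD, hcell, hsp, W', hW0, hpair, hsum⟩ := ep_close h hε hε1 n hn hD (by omega)
    have hR0 := h.R0
    have h1 := h.amn
    have h2 := h.mnb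
    have h3 := h.loa
    have h4 := h.bhi
    have hoL := h.oL
    have hdD' : (d : ℝ) ≤ D := by exact_mod_cast hdD
    have hq : 0 ≤ 24 * ((D : ℝ) + 1) ^ 2 / ε := by positivity
    by_cases hx : mn - R ≤ x ∧ x < mn + 2 * R
    · have hrng : ∀ c y, g c = some y → min a x ≤ y ∧ y ≤ max b x := by
        intro c y hy
        have := h.rng c y hy
        exact ⟨(min_le_left _ _).trans this.1, this.2.trans (le_max_left _ _)⟩
      have hat : min a x = x ∨ ∃ c, g c = some (min a x) := by
        rcases min_choice a x with e | e
        · rw [e]; exact Or.inr h.atta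
        · exact Or.inl e
      have hbt : max b x = x ∨ ∃ c, g c = some (max b x) := by
        rcases max_choice b x with e | e
        · rw [e]; exact Or.inr h.attb
        · exact Or.inl e
      have k1 : min a x ≤ mn := (min_le_left _ _).trans h1
      have k2 : mn + R ≤ max b x := h2.trans (le_max_left _ _)
      have k3 : mn - R ≤ min a x := le_min h3 hx.1
      have k4 : max b x ≤ mn + 2 * R := max_le h4 hx.2.le
      by_cases hk : ε * k < (d + 1) * 2 ^ (d + 1)
      · -- continue the epoch
        obtain ⟨c, hfc, hA⟩ := alloc_step d k f ⌊(x - (mn - R)) / (3 * R / 2 ^ d)⌋₊ h.al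
          (label_lt _ _ _ _ hR0 (Or.inl (by linarith [hx.2])))
        have hgc : g (o + c) = none := by
          by_contra hne
          obtain ⟨y, hy⟩ := Option.ne_none_iff_exists'.mp hne
          rw [h.lab _ _ hy] at hfc
          simp at hfc
        have hup : ∀ y, (∃ c, g c = some y) →
            ∃ c', Function.update g (o + c) (some x) c' = some y := by
          rintro y ⟨c', hc'⟩
          refine ⟨c', ?_⟩
          rw [Function.update_of_ne, hc']
          rintro rfl
          rw [hgc] at hc'
          simp at hc'
        refine ⟨o + c, hgc, Or.inr ⟨o, L, k + 1, d, mn, R, min a x, max b x, _, W,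
          ⟨hR0, k1, k2, k3, k4, ?_, ?_, ?_, hA, ?_, h.W0, ?_, h.sum, h.oL, h.space, ?_⟩, by omega⟩⟩
        · intro c' y hy
          by_cases hcc : c' = o + c
          · subst hcc
            rw [Function.update_self] at hy
            simp at hy
            subst hy
            exact ⟨min_le_right _ _, le_max_right _ _⟩
          · rw [Function.update_of_ne hcc] at hy
            exact hrng _ _ hy
        · rcases hat with e | e
          · exact ⟨o + c, by rw [Function.update_self, e]⟩
          · exact hup _ e
        · rcases hbt with e | e
          · exact ⟨o + c, by rw [Function.update_self, e]⟩
          · exact hup _ e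
        · intro c' y hy
          by_cases hcc : c' = c
          · subst hcc
            rw [Function.update_self] at hy
            simp at hy
            subst hy
            rw [Function.update_self]
          · rw [Function.update_of_ne (by omega)] at hy
            rw [Function.update_of_ne hcc]
            exact h.lab _ _ hy
        · intro c1 c2 y z h12 h2 hy hz
          rw [Function.update_of_ne (by omega)] at hy hz
          exact h.pair c1 c2 y z h12 h2 hy hz
        · push_cast
          nlinarith
      · -- next epoch in the same phase
        obtain ⟨c, f', hc, hE⟩ := ep_start (ε := ε) (D := D) (g := g) (o := o + k + d * 2 ^ d)
          (L := L + k) (d := d + 1) (mn := mn) (R := R) (a := min a x) (b := max b x) (W := W') x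
          hε1 hR0 k1 k2 k3 k4 hrng (min_le_right _ _) (le_max_right _ _) (Or.inl hx.2) hat hbt
          hcell hW0 hpair (by push_cast; exact hsum) (by omega) (by
            have := h.space
            push_cast
            push Not at hk
            linarith)
        exact ⟨c, hc, Or.inr ⟨_, _, _, _, _, _, _, _, _, _, hE, rfl⟩⟩
    · -- new phase
      have hRR : 2 * R ≤ max b x - min a x := by
        have m1 := min_le_left a x
        have m2 := min_le_right a x
        have m3 := le_max_left b x
        have m4 := le_max_right b x
        by_cases hx1 : mn - R ≤ x
        · have : mn + 2 * R ≤ x := by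
            by_contra hc
            push Not at hc
            exact hx ⟨hx1, hc⟩
          linarith
        · push Not at hx1
          linarith
      have hrng : ∀ c y, g c = some y → min a x ≤ y ∧ y ≤ max b x := by
        intro c y hy
        have := h.rng c y hy
        exact ⟨(min_le_left _ _).trans this.1, this.2.trans (le_max_left _ _)⟩
      have hat : min a x = x ∨ ∃ c, g c = some (min a x) := by
        rcases min_choice a x with e | e
        · rw [e]; exact Or.inr h.atta
        · exact Or.inl e
      have hbt : max b x = x ∨ ∃ c, g c = some (max b x) := by
        rcases max_choice b x with e | e
        · rw [e]; exact Or.inr h.attb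
        · exact Or.inl e
      have hxb : x ≤ max b x := le_max_right _ _
      have hxa : min a x ≤ x := min_le_right _ _
      generalize max b x = b' at *
      generalize min a x = a' at *
      obtain ⟨c, f', hc, hE⟩ := ep_start (ε := ε) (D := D) (g := g) (o := o + k + d * 2 ^ d)
        (L := L + k) (d := 0) (mn := a') (R := b' - a') (a := a') (b := b') (W := W') x
        hε1 (by linarith) le_rfl (by linarith) (by linarith) (by linarith) hrng hxa hxb
        (by
          rcases (show (0 : ℝ) ≤ b' - a' by linarith).eq_or_lt with e | e
          · right; exact e.symm
          · left; linarith) hat hbt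
        hcell hW0 hpair (by
          refine hsum.trans (mul_le_mul_of_nonneg_left ?_ hq)
          push_cast
          have : 0 ≤ (D : ℝ) := by positivity
          nlinarith) (by omega) (by
          simpa using hsp)
      exact ⟨c, hc, Or.inr ⟨_, _, _, _, _, _, _, _, _, _, hE, rfl⟩⟩

theorem sum_unique {α : Type*} [Fintype α] (Q : α → Prop) [DecidablePred Q] (w : ℝ) (hw : 0 ≤ w)
    (h : ∀ x y, Q x → Q y → x = y) : (∑ x, if Q x then w else 0) ≤ w := by
  rw [← Finset.sum_filter, Finset.sum_const, nsmul_eq_mul]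
  have : (Finset.univ.filter Q).card ≤ 1 := by
    rw [Finset.card_le_one]
    intro x hx y hy
    simp at hx hy
    exact h x y hx hy
  have : ((Finset.univ.filter Q).card : ℝ) ≤ 1 := by exact_mod_cast this
  nlinarith

theorem cost_le {n m : ℕ} (a : Fin n → ℝ) (pl : Fin n → Fin m) (W : ℕ → ℝ) (N : ℕ)
    (W0 : ∀ p, 0 ≤ W p) (hN : ∀ t, (pl t).1 < N)
    (pair : ∀ s t, (pl s).1 < (pl t).1 →
      |a s - a t| ≤ ∑ p ∈ Finset.Ioc (pl s).1 (pl t).1, W p) :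
    configCost (config a pl) ≤ ∑ p ∈ Finset.range N, W p := by
  set g := config a pl with hg
  have hsome : ∀ i, (g i).isSome = true → ∃ t, pl t = i ∧ g i = some (a t) := by
    intro i hi
    by_cases h : ∃ t, pl t = i
    · exact ⟨h.choose, h.choose_spec, by simp only [hg, config, dif_pos h]⟩
    · simp only [hg, config, dif_neg h] at hi
      simp at hi
  let Q : ℕ → Fin m × Fin m → Prop := fun p x =>
    ((g x.1).isSome = true ∧ (g x.2).isSome = true ∧ x.1 < x.2 ∧
        (∀ k : Fin m, x.1 < k → k < x.2 → g k = none)) ∧ x.1.1 < p ∧ p ≤ x.2.1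
  have h1 : configCost g ≤ ∑ x : Fin m × Fin m, ∑ p ∈ Finset.range N, if Q p x then W p else 0 := by
    unfold configCost
    rw [Fintype.sum_prod_type]
    apply Finset.sum_le_sum
    intro i _
    apply Finset.sum_le_sum
    intro j _
    split_ifs with hc
    · obtain ⟨s, hs, hs'⟩ := hsome i hc.1
      obtain ⟨t, ht, ht'⟩ := hsome j hc.2.1
      have hlt : (pl s).1 < (pl t).1 := by rw [hs, ht]; exact hc.2.2.1
      have e : |(g i).getD 0 - (g j).getD 0| = |a s - a t| := by rw [hs', ht']; rfl
      rw [e]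
      refine (pair s t hlt).trans ?_
      rw [← Finset.sum_filter]
      apply Finset.sum_le_sum_of_subset_of_nonneg
      · intro p hp
        rw [Finset.mem_Ioc, hs, ht] at hp
        rw [Finset.mem_filter, Finset.mem_range]
        have := hN t
        rw [ht] at this
        exact ⟨by omega, hc, hp.1, hp.2⟩
      · intro p _ _
        exact W0 p
    · apply Finset.sum_nonneg
      intro p _
      split_ifs
      · exact W0 p
      · exact le_rfl
  refine h1.trans ?_
  rw [Finset.sum_comm]
  apply Finset.sum_le_sum
  intro p _
  apply sum_unique _ _ (W0 p)
  rintro ⟨i, j⟩ ⟨i', j'⟩ ⟨⟨a1, a2, a3, a4⟩, a5, a6⟩ ⟨⟨b1, b2, b3, b4⟩, b5, b6⟩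
  simp only at *
  have key : ∀ k, (g k).isSome = true → g k ≠ none := by
    intro k hk h
    rw [h] at hk
    simp at hk
  have e1 : i = i' := by
    rcases lt_trichotomy i i' with h | h | h
    · exact absurd (a4 i' h (Fin.lt_def.mpr (by omega))) (key _ b1)
    · exact h
    · exact absurd (b4 i h (Fin.lt_def.mpr (by omega))) (key _ a1)
  have e2 : j = j' := by
    rcases lt_trichotomy j j' with h | h | h
    · exact absurd (b4 j (Fin.lt_def.mpr (by omega)) h) (key _ a2)
    · exact h
    · exact absurd (a4 j' (Fin.lt_def.mpr (by omega)) h) (key _ b2)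
  rw [e1, e2]

/-- One step of the online algorithm. -/
def nxt (ε : ℝ) (D : ℕ) (s : (ℕ → Option ℝ) × ℕ × ℕ) (x : ℝ) : (ℕ → Option ℝ) × ℕ × ℕ :=
  if h : ∃ c, s.1 c = none ∧ InvS ε D (Function.update s.1 c (some x)) (s.2.1 + 1) then
    (Function.update s.1 h.choose (some x), s.2.1 + 1, h.choose)
  else s

/-- The state after processing a list of elements. -/
def run (ε : ℝ) (D : ℕ) (l : List ℝ) : (ℕ → Option ℝ) × ℕ × ℕ :=
  l.foldl (nxt ε D) (fun _ => none, 0, 0)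

theorem nxt_spec (ε : ℝ) (D : ℕ) (s : (ℕ → Option ℝ) × ℕ × ℕ) (x : ℝ) (k : ℕ)
    (hk : s.2.1 = k)
    (h : ∃ c, s.1 c = none ∧ InvS ε D (Function.update s.1 c (some x)) (k + 1)) :
    ∃ c, s.1 c = none ∧ InvS ε D (Function.update s.1 c (some x)) (k + 1) ∧
      nxt ε D s x = (Function.update s.1 c (some x), k + 1, c) := by
  subst hk
  exact ⟨h.choose, h.choose_spec.1, h.choose_spec.2, by unfold nxt; rw [dif_pos h]⟩

theorem run_props (ε : ℝ) (D n : ℕ) (hε : 0 < ε) (hε1 : ε ≤ 1) (hn : 1 ≤ n)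
    (hD : D = Nat.log 2 n) (a : Fin n → ℝ) :
    ∃ (G : ℕ → ℕ → Option ℝ) (c : ℕ → ℕ),
      (∀ t, c t = (run ε D ((List.ofFn a).take (t + 1))).2.2) ∧
      (G 0 = fun _ => none) ∧
      (∀ k ≤ n, InvS ε D (G k) k) ∧
      (∀ t : Fin n, G t.1 (c t.1) = none ∧
        G (t.1 + 1) = Function.update (G t.1) (c t.1) (some (a t))) := by
  have hrec : ∀ t : Fin n, run ε D ((List.ofFn a).take (t.1 + 1)) =
      nxt ε D (run ε D ((List.ofFn a).take t.1)) (a t) := by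
    intro t
    have ht : t.1 < (List.ofFn a).length := by simp
    unfold run
    rw [List.take_succ_eq_append_getElem ht, List.foldl_append]
    simp
  have hinv : ∀ k ≤ n, InvS ε D (run ε D ((List.ofFn a).take k)).1 k ∧
      (run ε D ((List.ofFn a).take k)).2.1 = k := by
    intro k
    induction k with
    | zero => intro _; exact ⟨Or.inl ⟨rfl, by simp [run]⟩, by simp [run]⟩
    | succ k ih =>
      intro hk
      obtain ⟨i1, i2⟩ := ih (by omega)
      have := hrec ⟨k, by omega⟩
      simp only at this
      rw [this]
      have hex := inv_step i1 hε hε1 n hn hD (by omega) (a ⟨k, by omega⟩)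
      obtain ⟨c, -, hc2, hc3⟩ := nxt_spec ε D _ _ k i2 hex
      rw [hc3]
      exact ⟨hc2, rfl⟩
  refine ⟨fun k => (run ε D ((List.ofFn a).take k)).1,
    fun t => (run ε D ((List.ofFn a).take (t + 1))).2.2, fun _ => rfl, by simp [run],
    fun k hk => (hinv k hk).1, ?_⟩
  intro t
  obtain ⟨i1, i2⟩ := hinv t.1 t.2.le
  have hex := inv_step i1 hε hε1 n hn hD t.2.le (a t)
  obtain ⟨c, hc1, -, hc3⟩ := nxt_spec ε D _ _ t.1 i2 hex
  simp only [hrec t, hc3]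
  exact ⟨hc1, trivial⟩

theorem statement5 :
    ∃ C : ℝ, 0 < C ∧
      ∀ n : ℕ, 2 ≤ n → ∀ ε : ℝ, 3 * Real.logb 2 n / n ≤ ε → ε ≤ 1 →
        ∃ m : ℕ, (m : ℝ) ≤ (1 + ε) * n ∧
          ∃ strat : List ℝ → Fin m,
            ∀ a : Fin n → ℝ,
              Function.Injective (place strat a) ∧
              configCost (config a (place strat a)) ≤
                (C * (Real.logb 2 n) ^ 3 / ε) * ((⨆ t, a t) - (⨅ t, a t)) := by
  refine ⟨384, by norm_num, ?_⟩
  intro n hn ε hεl hε1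
  have hn' : (2 : ℝ) ≤ n := by exact_mod_cast hn
  have hlog : 1 ≤ Real.logb 2 n := by
    rw [Real.le_logb_iff_rpow_le (by norm_num) (by linarith)]
    simpa using hn'
  have hε : 0 < ε := by
    refine lt_of_lt_of_le ?_ hεl
    positivity
  have hDlog : ((Nat.log 2 n : ℕ) : ℝ) ≤ Real.logb 2 n := by
    have := Real.natLog_le_logb n 2
    exact_mod_cast this
  have hmn : n ≤ ⌊(1 + ε) * n⌋₊ := Nat.le_floor (by nlinarith)
  have hm0 : 0 < ⌊(1 + ε) * n⌋₊ := by omega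
  refine ⟨⌊(1 + ε) * n⌋₊, Nat.floor_le (by positivity),
    fun l => if h : (run ε (Nat.log 2 n) l).2.2 < ⌊(1 + ε) * n⌋₊ then ⟨_, h⟩ else ⟨0, hm0⟩, ?_⟩
  intro a
  obtain ⟨G, c, hc, hG0, hGinv, hGstep⟩ :=
    run_props ε (Nat.log 2 n) n hε hε1 (by omega) rfl a
  have hmem : ∀ k ≤ n, ∀ t : Fin n, t.1 < k → G k (c t.1) = some (a t) := by
    intro k
    induction k with
    | zero => intro _ t ht; omega
    | succ k ih =>
      intro hk t ht
      obtain ⟨s1, s2⟩ := hGstep ⟨k, by omega⟩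
      simp only at s1 s2
      rw [s2]
      by_cases htk : t.1 = k
      · subst htk
        rw [Function.update_self]
      · have := ih (by omega) t (by omega)
        rw [Function.update_of_ne, this]
        intro he
        rw [he, s1] at this
        simp at this
  have hmem' : ∀ k ≤ n, ∀ i x, G k i = some x → ∃ t, x = a t := by
    intro k
    induction k with
    | zero => intro _ i x hx; rw [hG0] at hx; simp at hx
    | succ k ih =>
      intro hk i x hx
      obtain ⟨s1, s2⟩ := hGstep ⟨k, by omega⟩
      simp only at s1 s2
      rw [s2] at hx
      by_cases hik : i = c k
      · subst hik
        rw [Function.update_self] at hx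
        simp at hx
        exact ⟨_, hx.symm⟩
      · rw [Function.update_of_ne hik] at hx
        exact ih (by omega) i x hx
  have hcinj : ∀ t u : Fin n, c t.1 = c u.1 → t = u := by
    have key : ∀ t u : Fin n, t < u → c t.1 ≠ c u.1 := by
      intro t u htu he
      have h1 := hmem u.1 u.2.le t htu
      rw [he, (hGstep u).1] at h1
      simp at h1
    intro t u he
    rcases lt_trichotomy t u with h | h | h
    · exact absurd he (key t u h)
    · exact h
    · exact absurd he.symm (key u t h)
  rcases hGinv n le_rfl with ⟨h0, _⟩ | ⟨o, L, k, d, mn, R, lo, hi, f, W, hE, hLk⟩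
  · omega
  obtain ⟨hdD, hcell, hsp, W', hW0, hpair, hsum⟩ :=
    ep_close hE hε hε1 n (by omega) rfl (by omega)
  rw [hLk] at hsp
  have hfl : o + k + d * 2 ^ d ≤ ⌊(1 + ε) * n⌋₊ := Nat.le_floor hsp
  have hclt : ∀ t : Fin n, c t.1 < o + k + d * 2 ^ d := fun t =>
    hcell _ _ (hmem n le_rfl t t.2)
  have hpl : ∀ t : Fin n, (place (fun l => if h : (run ε (Nat.log 2 n) l).2.2 < ⌊(1 + ε) * n⌋₊
      then (⟨_, h⟩ : Fin ⌊(1 + ε) * n⌋₊) else ⟨0, hm0⟩) a t).1 = c t.1 := by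
    intro t
    have h1 := hclt t
    have h2 := hc t.1
    unfold place
    dsimp only
    rw [dif_pos (by omega)]
    exact h2.symm
  refine ⟨?_, ?_⟩
  · intro t u he
    apply hcinj
    rw [← hpl t, ← hpl u, he]
  · refine (cost_le a _ W' (o + k + d * 2 ^ d) hW0 ?_ ?_).trans (hsum.trans ?_)
    · intro t
      rw [hpl]
      exact hclt t
    · intro s t hst
      rw [hpl, hpl] at hst ⊢
      exact hpair _ _ _ _ hst (hmem n le_rfl s s.2) (hmem n le_rfl t t.2)
    · have hR0 := hE.R0
      have hRO : R ≤ (⨆ t, a t) - (⨅ t, a t) := by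
        obtain ⟨i, hi'⟩ := hE.atta
        obtain ⟨j, hj'⟩ := hE.attb
        obtain ⟨s, hs⟩ := hmem' n le_rfl _ _ hi'
        obtain ⟨t, ht⟩ := hmem' n le_rfl _ _ hj'
        have h1 : (⨅ t, a t) ≤ lo := by
          rw [hs]; exact ciInf_le (Set.finite_range a).bddBelow s
        have h2 : hi ≤ (⨆ t, a t) := by
          rw [ht]; exact le_ciSup (Set.finite_range a).bddAbove t
        have := hE.amn
        have := hE.mnb
        linarith
      have hdD' : (d : ℝ) ≤ (Nat.log 2 n : ℕ) := by exact_mod_cast hdD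
      have hD0 : (0 : ℝ) ≤ (Nat.log 2 n : ℕ) := by positivity
      have hD2 : ((Nat.log 2 n : ℕ) : ℝ) + 1 ≤ 2 * Real.logb 2 n := by linarith
      generalize ((Nat.log 2 n : ℕ) : ℝ) = D at *
      generalize Real.logb 2 n = ℓ at *
      generalize (⨆ t, a t) - (⨅ t, a t) = O at *
      calc 24 * (D + 1) ^ 2 / ε * ((D + 1 + (d + 1)) * R)
          ≤ 24 * (D + 1) ^ 2 / ε * ((2 * (D + 1)) * O) := by
            gcongr
            linarith
        _ = 48 * (D + 1) ^ 3 / ε * O := by ring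
        _ ≤ 48 * (2 * ℓ) ^ 3 / ε * O := by
            have : 0 ≤ O := by linarith
            gcongr
        _ = _ := by ring
end
end

section
/- There is an absolute constant C such that for every integer n ≥ 2 and every real γ with 1 ≤ γ ≤ (log₂ n)², there is a deterministic online algorithm for online sorting with unknown range that uses an array of at most C·γ·n cells and is C·(log₂ n)³/γ-competitive. -/
/-!
Online sorting with unknown range (see stmt_5 for the model).

STATEMENT 6: there is an absolute constant `C` such that for every `n ≥ 2` and every `γ`
with `1 ≤ γ ≤ (log₂ n)²` there is a deterministic online algorithm for unknown range using
at most `C γ n` cells that is `C (log₂ n)³ / γ`-competitive.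
-/

noncomputable section
attribute [local instance] Classical.propDecidable

namespace OS

/-- total variation of a list -/
def V : List ℝ → ℝ
  | [] => 0
  | [_] => 0
  | x :: y :: l => |x - y| + V (y :: l)

theorem V_nonneg : ∀ l, 0 ≤ V l
  | [] => le_refl _
  | [_] => le_refl _
  | x :: y :: l => by
      have := V_nonneg (y :: l)
      simp only [V]; positivity

theorem V_split (l1 l2 : List ℝ) (x : ℝ) :
    V (l1 ++ x :: l2) = V (l1 ++ [x]) + V (x :: l2) := by
  induction l1 with
  | nil => simp [V]
  | cons a l ih =>
    cases l with
    | nil => simp [V]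
    | cons b l => simp only [List.cons_append, V] at ih ⊢; rw [ih]; ring

theorem V_snoc_le (l : List ℝ) (x W : ℝ) (hW : 0 ≤ W) (h : ∀ y ∈ l, |y - x| ≤ W) :
    V (l ++ [x]) ≤ V l + W := by
  induction l with
  | nil => simpa [V] using hW
  | cons a l ih =>
    cases l with
    | nil => simpa [V] using h a (by simp)
    | cons b l =>
      have := ih (fun y hy => h y (by simp at hy ⊢; tauto))
      simp only [List.cons_append, V] at this ⊢; linarith

theorem V_append_le (l1 l2 : List ℝ) (W : ℝ) (hW : 0 ≤ W)
    (h : ∀ x ∈ l1, ∀ y ∈ l2, |x - y| ≤ W) : V (l1 ++ l2) ≤ V l1 + V l2 + W := by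
  cases l2 with
  | nil => simp [V]; linarith
  | cons x l2 =>
    rw [V_split]
    have := V_snoc_le l1 x W hW (fun y hy => h y hy x (by simp))
    linarith

theorem V_tail_le (x : ℝ) (l : List ℝ) : V l ≤ V (x :: l) := by
  cases l with
  | nil => simp [V]
  | cons y l => simp only [V]; have := abs_nonneg (x - y); linarith

theorem V_delete (l1 l2 : List ℝ) (x : ℝ) : V (l1 ++ l2) ≤ V (l1 ++ x :: l2) := by
  induction l1 with
  | nil => exact V_tail_le x l2
  | cons a l ih =>
    cases l with
    | nil =>
      cases l2 with
      | nil => simp [V]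
      | cons y l2 =>
        simp only [List.cons_append, List.nil_append, V]
        have := abs_sub_le a x y
        linarith
    | cons b l => simp only [List.cons_append, V] at ih ⊢; linarith

theorem V_insert (a w : ℝ) (own l : List ℝ) (hw : 0 ≤ w)
    (h : ∀ x ∈ own, a ≤ x ∧ x ≤ a + w) :
    V (a :: (own ++ l)) ≤ 2 * w + V own + V (a :: l) := by
  have h1 := V_delete (a :: own) l a
  rw [V_split] at h1
  have h2 := V_append_le ([a]) (own ++ [a]) w hw (by
    intro x hx y hy
    simp at hx hy
    subst hx
    rcases hy with hy | hy
    · have := h y hy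
      rw [abs_le]; constructor <;> linarith
    · subst hy; simpa using hw)
  have h3 := V_append_le own [a] w hw (by
    intro x hx y hy
    simp at hy
    subst hy
    have := h x hx
    rw [abs_le]; constructor <;> linarith)
  simp [V] at h1 h2 h3
  linarith

/-- values in the first `n` cells -/
def vals (f : ℕ → Option ℝ) (n : ℕ) : List ℝ := (List.range n).filterMap f

theorem mem_vals {f : ℕ → Option ℝ} {n : ℕ} {x : ℝ} :
    x ∈ vals f n ↔ ∃ i < n, f i = some x := by
  simp [vals]

theorem vals_congr {f g : ℕ → Option ℝ} {n : ℕ} (h : ∀ i < n, f i = g i) :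
    vals f n = vals g n := by
  unfold vals
  apply List.filterMap_congr
  intro i hi
  exact h i (by simpa using hi)

theorem vals_add (f : ℕ → Option ℝ) (m n : ℕ) :
    vals f (m + n) = vals f m ++ vals (fun i => f (m + i)) n := by
  simp only [vals, List.range_add, List.filterMap_append, List.filterMap_map]
  rfl

theorem vals_none {f : ℕ → Option ℝ} {n : ℕ} (h : ∀ i < n, f i = none) : vals f n = [] := by
  rw [vals_congr (g := fun _ => none) h]
  simp [vals]

/-- `f` on the first `m` cells, then `g` -/
def glue (m : ℕ) (f g : ℕ → Option ℝ) : ℕ → Option ℝ := fun i => if i < m then f i else g (i - m)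

theorem vals_glue (f g : ℕ → Option ℝ) (m n : ℕ) :
    vals (glue m f g) (m + n) = vals f m ++ vals g n := by
  rw [vals_add]
  congr 1
  · apply vals_congr; intro i hi; simp [glue, hi]
  · apply vals_congr; intro i hi; simp [glue]

/-- one empty cell is filled with `x` -/
def Upd (f f' : ℕ → Option ℝ) (i : ℕ) (x : ℝ) : Prop :=
  f i = none ∧ f' i = some x ∧ ∀ j, j ≠ i → f' j = f j

theorem Upd.glue_left {f f' : ℕ → Option ℝ} {i : ℕ} {x : ℝ} (h : Upd f f' i x) {m : ℕ}
    (hi : i < m) (g : ℕ → Option ℝ) : Upd (glue m f g) (glue m f' g) i x := by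
  obtain ⟨h1, h2, h3⟩ := h
  refine ⟨by simp [glue, hi, h1], by simp [glue, hi, h2], fun j hj => ?_⟩
  simp only [glue]; split_ifs <;> simp [h3 j hj]

theorem Upd.glue_right {g g' : ℕ → Option ℝ} {i : ℕ} {x : ℝ} (h : Upd g g' i x) (m : ℕ)
    (f : ℕ → Option ℝ) : Upd (glue m f g) (glue m f g') (m + i) x := by
  obtain ⟨h1, h2, h3⟩ := h
  refine ⟨by simp [glue, h1], by simp [glue, h2], fun j hj => ?_⟩
  simp only [glue]; split_ifs with hh
  · rfl
  · exact h3 _ (by omega)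

/-- concatenation of chunks of size `s` -/
def cat (s : ℕ) (t : ℕ → ℕ → Option ℝ) : ℕ → Option ℝ := fun o => t (o / s) (o % s)

theorem vals_cat_succ (s p : ℕ) (t : ℕ → ℕ → Option ℝ) :
    vals (cat s t) ((p + 1) * s) = vals (cat s t) (p * s) ++ vals (t p) s := by
  rw [add_mul, one_mul, vals_add]
  congr 1
  apply vals_congr; intro i hi
  have hs : 0 < s := by omega
  have h1 : (p * s + i) / s = p := by
    rw [mul_comm, Nat.mul_add_div hs, Nat.div_eq_of_lt hi]; simp
  have h2 : (p * s + i) % s = i := by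
    rw [mul_comm, Nat.mul_add_mod, Nat.mod_eq_of_lt hi]
  simp [cat, h1, h2]

theorem mem_vals_cat {s p : ℕ} {t : ℕ → ℕ → Option ℝ} {x : ℝ}
    (h : x ∈ vals (cat s t) (p * s)) : ∃ j < p, x ∈ vals (t j) s := by
  induction p with
  | zero => simp [vals] at h
  | succ p ih =>
    rw [vals_cat_succ, List.mem_append] at h
    rcases h with h | h
    · obtain ⟨j, hj, hx⟩ := ih h
      exact ⟨j, by omega, hx⟩
    · exact ⟨p, by omega, h⟩

/-- cost of a concatenation -/
theorem V_cat (s p R : ℕ) (t : ℕ → ℕ → Option ℝ) (k0 : ℕ) (a W : ℝ) (hW : 0 ≤ W)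
    (hnone : ∀ r, R ≤ r → ∀ o, t r o = none)
    (hin : ∀ r o x, t r o = some x → a ≤ x ∧ x ≤ a + W) :
    V (vals (cat s (fun j => t (k0 + j))) (p * s)) ≤
      ∑ j ∈ Finset.range p, (if k0 + j < R then V (vals (t (k0 + j)) s) + W else 0) := by
  induction p with
  | zero => simp [vals, V]
  | succ p ih =>
    rw [vals_cat_succ, Finset.sum_range_succ]
    split_ifs with h
    · have := V_append_le (vals (cat s (fun j => t (k0 + j))) (p * s)) (vals (t (k0 + p)) s) W hW (by
        intro x hx y hy
        obtain ⟨j, hj, hx⟩ := mem_vals_cat hx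
        obtain ⟨i, hi, hx⟩ := mem_vals.1 hx
        obtain ⟨i', hi', hy⟩ := mem_vals.1 hy
        have h1 := hin _ _ _ hx
        have h2 := hin _ _ _ hy
        rw [abs_le]; constructor <;> linarith)
      linarith
    · rw [vals_none (fun i _ => hnone _ (by omega) i)]
      simpa using ih

theorem Upd.cat {t t' : ℕ → ℕ → Option ℝ} {r o s : ℕ} {x : ℝ} (ho : o < s)
    (h : Upd (t r) (t' r) o x) (h' : ∀ r', r' ≠ r → t' r' = t r') :
    Upd (cat s t) (cat s t') (r * s + o) x := by
  have hs : 0 < s := by omega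
  have h1 : (r * s + o) / s = r := by
    rw [mul_comm, Nat.mul_add_div hs, Nat.div_eq_of_lt ho]; simp
  have h2 : (r * s + o) % s = o := by
    rw [mul_comm, Nat.mul_add_mod, Nat.mod_eq_of_lt ho]
  obtain ⟨u1, u2, u3⟩ := h
  refine ⟨by simp [OS.cat, h1, h2, u1], by simp [OS.cat, h1, h2, u2], fun j hj => ?_⟩
  simp only [OS.cat]
  by_cases hr : j / s = r
  · rw [hr]
    apply u3
    intro hc
    apply hj
    rw [← hr, ← hc, mul_comm, Nat.div_add_mod]
  · rw [h' _ hr]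

/-- a step in a stream of chunks of size `s` -/
def SStep (s : ℕ) (t t' : ℕ → ℕ → Option ℝ) (R R' : ℕ) (x : ℝ) : Prop :=
  ∃ r o, o < s ∧ r < R' ∧ (R' = R ∨ (R' = R + 1 ∧ r = R)) ∧ Upd (t r) (t' r) o x ∧
    ∀ r', r' ≠ r → t' r' = t r'

/-- pack `p` slots into a chunk -/
def own (s p : ℕ) (t : ℕ → ℕ → Option ℝ) (k : ℕ) : ℕ → Option ℝ :=
  cat s (fun j => if j < p then t (p * k + j) else fun _ => none)

theorem vals_own (s p : ℕ) (t : ℕ → ℕ → Option ℝ) (k : ℕ) :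
    vals (own s p t k) (p * s) = vals (cat s (fun j => t (p * k + j))) (p * s) := by
  apply vals_congr
  intro i hi
  have : i / s < p := Nat.div_lt_of_lt_mul (by rwa [mul_comm])
  simp [own, cat, this]

theorem pack_step {s p : ℕ} (hp : 0 < p) {t t' : ℕ → ℕ → Option ℝ} {R R' : ℕ} {x : ℝ}
    (h : SStep s t t' R R' x) :
    (∃ i < p * s, Upd (own s p t 0) (own s p t' 0) i x ∧
      (∀ k, own s p t' (k + 1) = own s p t (k + 1)) ∧ (R' - 1) / p = (R - 1) / p) ∨
    (own s p t' 0 = own s p t 0 ∧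
      SStep (p * s) (fun k => own s p t (k + 1)) (fun k => own s p t' (k + 1))
        ((R - 1) / p) ((R' - 1) / p) x) := by
  obtain ⟨r, o, ho, hr, hR, hu, hne⟩ := h
  have hmod : r % p < p := Nat.mod_lt _ hp
  have hdm : p * (r / p) + r % p = r := Nat.div_add_mod r p
  have hoff : r % p * s + o < p * s := by
    have : (r % p + 1) * s ≤ p * s := Nat.mul_le_mul_right _ hmod
    rw [add_mul] at this
    omega
  have hU : Upd (own s p t (r / p)) (own s p t' (r / p)) (r % p * s + o) x := by
    apply Upd.cat ho
    · simpa [hmod, hdm] using hu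
    · intro j hj
      split_ifs with hjp
      · apply hne
        intro hc
        apply hj
        rw [← hc, Nat.mul_add_mod, Nat.mod_eq_of_lt hjp]
      · rfl
  have hO : ∀ k, k ≠ r / p → own s p t' k = own s p t k := by
    intro k hk
    unfold own
    congr 1
    funext j
    split_ifs with hjp
    · rw [hne]
      intro hc
      apply hk
      rw [← hc, Nat.mul_add_div hp, Nat.div_eq_of_lt hjp]; simp
    · rfl
  have hrle : r / p ≤ (R' - 1) / p := Nat.div_le_div_right (by omega)
  by_cases h0 : r / p = 0
  · left
    rw [h0] at hU
    refine ⟨_, hoff, hU, fun k => hO _ (by rw [h0]; simp), ?_⟩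
    rcases hR with hR | ⟨hR, hrR⟩
    · rw [hR]
    · subst hrR
      rw [hR, Nat.add_sub_cancel, h0]
      symm
      have : (r - 1) / p ≤ r / p := Nat.div_le_div_right (by omega)
      rw [h0] at this
      exact Nat.le_zero.1 this
  · right
    have h0' : 0 < r / p := Nat.pos_of_ne_zero h0
    refine ⟨hO 0 (fun h => h0 h.symm), r / p - 1, _, hoff, Nat.sub_one_lt_of_le h0' hrle, ?_, ?_, ?_⟩
    · rcases hR with hR | ⟨hR, hrR⟩
      · left; rw [hR]
      · subst hrR
        rw [hR, Nat.add_sub_cancel]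
        have h1 : (r - 1) / p ≤ r / p := Nat.div_le_div_right (by omega)
        have h2 : r / p ≤ (r - 1) / p + 1 := by
          calc r / p ≤ (r - 1 + p) / p := Nat.div_le_div_right (by omega)
            _ = (r - 1) / p + 1 := Nat.add_div_right _ hp
        generalize r / p = A at *
        generalize (r - 1) / p = B at *
        omega
    · have : r / p - 1 + 1 = r / p := Nat.sub_add_cancel h0'
      simpa only [this] using hU
    · intro k hk
      apply hO
      generalize r / p = A at *
      omega

theorem own_none {s p : ℕ} (hp : 0 < p) {t : ℕ → ℕ → Option ℝ} {R : ℕ}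
    (hnone : ∀ r, R ≤ r → ∀ o, t r o = none) (k : ℕ) (hk : (R - 1) / p ≤ k) (o : ℕ) :
    own s p t (k + 1) o = none := by
  simp only [own, cat]
  split_ifs with h
  · apply hnone
    have h1 : (R - 1) / p < k + 1 := by omega
    have h2 := (Nat.div_lt_iff_lt_mul hp).1 h1
    rw [mul_comm] at h2
    have h3 : R ≤ p * (k + 1) := by
      generalize p * (k + 1) = A at *
      omega
    exact h3.trans (Nat.le_add_right _ _)
  · rfl

theorem own_mem {s p : ℕ} {t : ℕ → ℕ → Option ℝ} {k o : ℕ} {x : ℝ}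
    (h : own s p t k o = some x) : ∃ r o', t r o' = some x := by
  simp only [own, cat] at h
  split_ifs at h with hh
  · exact ⟨_, _, h⟩

theorem sum_blocks (p M : ℕ) (c : ℕ → ℝ) :
    ∑ k ∈ Finset.range M, ∑ j ∈ Finset.range p, c (p * k + j) = ∑ r ∈ Finset.range (p * M), c r := by
  induction M with
  | zero => simp
  | succ M ih => rw [Finset.sum_range_succ, ih, mul_add, mul_one, Finset.sum_range_add]

theorem sum_trunc (M R : ℕ) (c : ℕ → ℝ) (hc : ∀ r, 0 ≤ c r) :
    ∑ r ∈ Finset.range M, (if r < R then c r else 0) ≤ ∑ r ∈ Finset.range R, c r := by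
  rw [← Finset.sum_filter]
  apply Finset.sum_le_sum_of_subset_of_nonneg
  · intro r; simp
  · intro i _ _; exact hc i

/-- cost of packing -/
theorem pack_cost {s p : ℕ} (hp : 0 < p) {t : ℕ → ℕ → Option ℝ} {R : ℕ} {a W : ℝ} (hW : 0 ≤ W)
    (hnone : ∀ r, R ≤ r → ∀ o, t r o = none)
    (hin : ∀ r o x, t r o = some x → a ≤ x ∧ x ≤ a + W) (l : List ℝ) :
    V (a :: (vals (own s p t 0) (p * s) ++ l)) +
      ∑ k ∈ Finset.range ((R - 1) / p), (V (vals (own s p t (k + 1)) (p * s)) + 2 * W)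
    ≤ V (a :: l) + ∑ r ∈ Finset.range R, V (vals (t r) s) + 3 * W * R := by
  rcases Nat.eq_zero_or_pos R with hR | hR
  · subst hR
    have : vals (own s p t 0) (p * s) = [] := by
      apply vals_none
      intro i _
      simp only [own, cat]
      split_ifs
      · exact hnone _ (Nat.zero_le _) _
      · rfl
    simp [this]
  · have h0 := V_insert a W (vals (own s p t 0) (p * s)) l hW (by
      intro x hx
      obtain ⟨i, _, hi⟩ := mem_vals.1 hx
      obtain ⟨r, o, h⟩ := own_mem hi
      exact hin _ _ _ h)
    have h1 : ∑ k ∈ Finset.range ((R - 1) / p + 1), V (vals (own s p t k) (p * s)) ≤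
        ∑ r ∈ Finset.range R, (V (vals (t r) s) + W) := by
      calc _ ≤ ∑ k ∈ Finset.range ((R - 1) / p + 1), ∑ j ∈ Finset.range p,
              (if p * k + j < R then V (vals (t (p * k + j)) s) + W else 0) := by
            apply Finset.sum_le_sum
            intro k _
            rw [vals_own]
            exact V_cat s p R t (p * k) a W hW hnone hin
        _ = _ := sum_blocks p _ (fun r => if r < R then V (vals (t r) s) + W else 0)
        _ ≤ _ := sum_trunc _ _ _ (fun r => add_nonneg (V_nonneg _) hW)
    rw [Finset.sum_range_succ'] at h1
    rw [Finset.sum_add_distrib] at h1 ⊢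
    simp only [Finset.sum_const, Finset.card_range, nsmul_eq_mul] at h1 ⊢
    have h2 : (((R - 1) / p : ℕ) : ℝ) + 1 ≤ R := by
      have : (R - 1) / p + 1 ≤ R := by
        have := Nat.div_le_self (R - 1) p
        omega
      exact_mod_cast this
    have h3 := mul_le_mul_of_nonneg_right h2 hW
    linarith

/-- the slots of two merged streams -/
def slotOf (lg : List Bool) (u : Bool → ℕ → ℕ → Option ℝ) (r : ℕ) : ℕ → Option ℝ :=
  match lg[r]? with
  | none => fun _ => none
  | some c => u c ((lg.take r).count c)

theorem slotOf_none {lg : List Bool} {u : Bool → ℕ → ℕ → Option ℝ} {r : ℕ}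
    (h : lg.length ≤ r) : slotOf lg u r = fun _ => none := by
  simp [slotOf, List.getElem?_eq_none h]

theorem slotOf_mem {lg : List Bool} {u : Bool → ℕ → ℕ → Option ℝ} {r o : ℕ} {x : ℝ}
    (h : slotOf lg u r o = some x) : ∃ c k, u c k o = some x := by
  unfold slotOf at h
  cases hl : lg[r]? with
  | none => simp [hl] at h
  | some c => rw [hl] at h; exact ⟨_, _, h⟩

theorem slotOf_append {lg : List Bool} {c : Bool} {u : Bool → ℕ → ℕ → Option ℝ} {r : ℕ}
    (h : r < lg.length) : slotOf (lg ++ [c]) u r = slotOf lg u r := by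
  unfold slotOf
  rw [List.getElem?_append_left h, List.take_append_of_le_length h.le]

theorem slotOf_last {lg : List Bool} {c : Bool} {u : Bool → ℕ → ℕ → Option ℝ} :
    slotOf (lg ++ [c]) u lg.length = u c (lg.count c) := by
  unfold slotOf
  simp

theorem sum_slotOf (lg : List Bool) (u : Bool → ℕ → ℕ → Option ℝ) (f : (ℕ → Option ℝ) → ℝ) :
    ∑ r ∈ Finset.range lg.length, f (slotOf lg u r) =
      ∑ k ∈ Finset.range (lg.count true), f (u true k) +
      ∑ k ∈ Finset.range (lg.count false), f (u false k) := by
  induction lg using List.reverseRecOn with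
  | nil => simp
  | append_singleton lg c ih =>
    rw [List.length_append, List.length_singleton, Finset.sum_range_succ, slotOf_last]
    rw [Finset.sum_congr rfl (fun r hr => by rw [slotOf_append (Finset.mem_range.1 hr)]), ih]
    cases c
    · rw [List.count_append, List.count_append]
      simp [Finset.sum_range_succ]; ring
    · rw [List.count_append, List.count_append]
      simp [Finset.sum_range_succ]; ring

theorem exists_slot (lg : List Bool) (c : Bool) (k : ℕ) (hk : k < lg.count c) :
    ∃ r < lg.length, lg[r]? = some c ∧ (lg.take r).count c = k := by
  induction lg using List.reverseRecOn with
  | nil => simp at hk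
  | append_singleton lg d ih =>
    by_cases h : k < lg.count c
    · obtain ⟨r, h1, h2, h3⟩ := ih h
      refine ⟨r, by simp; omega, ?_, ?_⟩
      · rw [List.getElem?_append_left h1, h2]
      · rw [List.take_append_of_le_length h1.le, h3]
    · rw [List.count_append] at hk
      have hd : d = c := by
        by_contra hne
        simp [hne] at hk
        omega
      subst hd
      simp at hk
      exact ⟨lg.length, by simp, by simp, by simp; omega⟩

theorem count_take_lt {lg : List Bool} {c : Bool} {r r' : ℕ} (hr : lg[r]? = some c) (h : r < r') :
    (lg.take r).count c < (lg.take r').count c := by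
  have h1 : (lg.take (r + 1)).count c = (lg.take r).count c + 1 := by
    rw [List.take_add_one, hr]; simp
  have h2 : (lg.take (r + 1)).count c ≤ (lg.take r').count c := by
    apply List.Sublist.count_le
    exact (List.take_prefix_take_left (by omega)).sublist
  omega

theorem merge_step {s : ℕ} {u u' : Bool → ℕ → ℕ → Option ℝ} {c : Bool} {K' : ℕ} {x : ℝ}
    {lg : List Bool} (hother : ∀ d, d ≠ c → u' d = u d)
    (h : SStep s (u c) (u' c) (lg.count c) K' x)
    (hnone : ∀ k, lg.count c ≤ k → ∀ o, u c k o = none) :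
    ((if K' = lg.count c then lg else lg ++ [c]).count c = K') ∧
    SStep s (slotOf lg u) (slotOf (if K' = lg.count c then lg else lg ++ [c]) u') lg.length
      (if K' = lg.count c then lg else lg ++ [c]).length x := by
  obtain ⟨k, o, ho, hk, hK, hu, hne⟩ := h
  rcases hK with hK | ⟨hK, hkK⟩
  · simp only [hK, if_true, true_and]
    obtain ⟨r, h1, h2, h3⟩ := exists_slot lg c k (by omega)
    refine ⟨r, o, ho, h1, Or.inl rfl, ?_, ?_⟩
    · simpa [slotOf, h2, h3] using hu
    · intro r' hr'
      unfold slotOf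
      split
      · rfl
      · rename_i d hd
        by_cases hdc : d = c
        · subst hdc
          apply hne
          rcases lt_or_gt_of_ne hr' with hlt | hlt
          · have := count_take_lt hd hlt; omega
          · have := count_take_lt h2 hlt; omega
        · rw [hother d hdc]
  · have hnK : K' ≠ lg.count c := by omega
    simp only [hnK, if_false]
    refine ⟨by simp [hK], lg.length, o, ho, by simp, Or.inr ⟨by simp, rfl⟩, ?_, ?_⟩
    · rw [slotOf_last, slotOf_none le_rfl, ← hkK]
      refine ⟨rfl, hu.2.1, fun j hj => ?_⟩
      rw [hu.2.2 j hj]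
      exact hnone _ hkK.ge _
    · intro r' hr'
      by_cases hlt : r' < lg.length
      · rw [slotOf_append hlt]
        unfold slotOf
        split
        · rfl
        · rename_i d hd
          by_cases hdc : d = c
          · subst hdc
            apply hne
            have := count_take_lt hd hlt
            rw [List.take_length] at this
            omega
          · rw [hother d hdc]
      · rw [slotOf_none (lg := lg) (by omega), slotOf_none (lg := lg ++ [c])
          (by rw [List.length_append, List.length_singleton]; omega)]

/-- an online structure: internal area of `A` cells, overflow chunks of `s` cells.
Lists are newest element first. -/
structure Str where
  A : ℕ
  s : ℕ
  int : List ℝ → ℕ → Option ℝ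
  ov : List ℝ → ℕ → ℕ → Option ℝ
  K : List ℝ → ℕ

structure Str.Valid (S : Str) : Prop where
  int_nil : ∀ i, S.int [] i = none
  K_nil : S.K [] = 0
  ov_none : ∀ l k, S.K l ≤ k → ∀ o, S.ov l k o = none
  int_mem : ∀ l i x, S.int l i = some x → x ∈ l
  ov_mem : ∀ l k o x, S.ov l k o = some x → x ∈ l
  step : ∀ l x, (∃ i < S.A, Upd (S.int l) (S.int (x :: l)) i x ∧ S.ov (x :: l) = S.ov l ∧
      S.K (x :: l) = S.K l) ∨
    (S.int (x :: l) = S.int l ∧ SStep S.s (S.ov l) (S.ov (x :: l)) (S.K l) (S.K (x :: l)) x)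

/-- the potential bounding the cost -/
def Str.Phi (S : Str) (a w : ℝ) (l : List ℝ) : ℝ :=
  V (a :: (vals (S.int l) S.A ++ [a + w])) +
    ∑ k ∈ Finset.range (S.K l), (V (vals (S.ov l k) S.s) + 2 * w)

def leafSlot (l : List ℝ) (r o : ℕ) : Option ℝ := if o = 0 then l.reverse[r]? else none

theorem leafSlot_mem {l : List ℝ} {r o : ℕ} {x : ℝ} (h : leafSlot l r o = some x) : x ∈ l := by
  unfold leafSlot at h
  split_ifs at h
  have := List.mem_of_getElem? h
  simpa using this

theorem leafSlot_none {l : List ℝ} {r o : ℕ} (h : l.length ≤ r) : leafSlot l r o = none := by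
  unfold leafSlot
  split_ifs
  · exact List.getElem?_eq_none (by simpa using h)
  · rfl

theorem leafSlot_step (l : List ℝ) (x : ℝ) :
    SStep 1 (leafSlot l) (leafSlot (x :: l)) l.length (x :: l).length x := by
  refine ⟨l.length, 0, by simp, by simp, Or.inr ⟨by simp, rfl⟩, ⟨leafSlot_none le_rfl, ?_, ?_⟩, ?_⟩
  · have : l.length = l.reverse.length := by simp
    simp [leafSlot]
  · intro j hj
    simp [leafSlot, hj]
  · intro r hr
    funext o
    unfold leafSlot
    split_ifs
    · rw [List.reverse_cons]
      by_cases h : r < l.length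
      · rw [List.getElem?_append_left (by simpa using h)]
      · rw [List.getElem?_eq_none, List.getElem?_eq_none]
        · simp; omega
        · simp; omega
    · rfl

def leaf (q : ℕ) : Str where
  A := q * 1
  s := q * 1
  int l := own 1 q (leafSlot l) 0
  ov l k := own 1 q (leafSlot l) (k + 1)
  K l := (l.length - 1) / q

theorem leaf_valid {q : ℕ} (hq : 0 < q) : (leaf q).Valid where
  int_nil i := by
    cases h : (leaf q).int [] i with
    | none => rfl
    | some x =>
      obtain ⟨r, o, h⟩ := own_mem h
      simpa using leafSlot_mem h
  K_nil := by simp [leaf]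
  ov_none l k hk o := own_none (s := 1) (t := leafSlot l) (R := l.length) hq
    (fun r hr o => leafSlot_none hr) k hk o
  int_mem l i x h := by
    obtain ⟨r, o, h⟩ := own_mem h
    exact leafSlot_mem h
  ov_mem l k o x h := by
    obtain ⟨r, o, h⟩ := own_mem h
    exact leafSlot_mem h
  step l x := by
    rcases pack_step hq (leafSlot_step l x) with ⟨i, hi, h1, h2, h3⟩ | ⟨h1, h2⟩
    · left
      exact ⟨i, hi, h1, funext h2, h3⟩
    · right
      exact ⟨h1, h2⟩

theorem V_single_slot (l : List ℝ) (r : ℕ) : V (vals (leafSlot l r) 1) = 0 := by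
  simp only [vals, List.range_one]
  cases h : leafSlot l r 0 <;> simp [h, V]

theorem leaf_phi {q : ℕ} (hq : 0 < q) {a w : ℝ} (hw : 0 ≤ w) {l : List ℝ}
    (hl : ∀ x ∈ l, a ≤ x ∧ x ≤ a + w) : (leaf q).Phi a w l ≤ w + 3 * w * l.length := by
  have h := pack_cost (s := 1) hq (t := leafSlot l) (R := l.length) (a := a) hw
    (fun r hr o => leafSlot_none hr) (fun r o x h => hl x (leafSlot_mem h)) [a + w]
  simp only [V_single_slot, Finset.sum_const_zero, V] at h
  have h2 : |a - (a + w)| = w := by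
    rw [show a - (a + w) = -w by ring, abs_neg, abs_of_nonneg hw]
  rw [h2] at h
  unfold Str.Phi leaf
  linarith

/-- request log of a node -/
def log (KL KR : List ℝ → ℕ) (mid : ℝ) : List ℝ → List Bool
  | [] => []
  | x :: l => if x < mid then
      (if KL (x :: l.filter (· < mid)) = KL (l.filter (· < mid)) then log KL KR mid l
        else log KL KR mid l ++ [true])
    else
      (if KR (x :: l.filter (¬ · < mid)) = KR (l.filter (¬ · < mid)) then log KL KR mid l
        else log KL KR mid l ++ [false])

def both (SL SR : Str) (mid : ℝ) (l : List ℝ) : Bool → ℕ → ℕ → Option ℝ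
  | true => SL.ov (l.filter (· < mid))
  | false => SR.ov (l.filter (¬ · < mid))

def nslot (SL SR : Str) (mid : ℝ) (l : List ℝ) : ℕ → ℕ → Option ℝ :=
  slotOf (log SL.K SR.K mid l) (both SL SR mid l)

def node (SL SR : Str) (mid : ℝ) : Str where
  A := 2 * SL.s + (SL.A + SR.A)
  s := 2 * SL.s
  int l := glue (2 * SL.s) (own SL.s 2 (nslot SL SR mid l) 0)
    (glue SL.A (SL.int (l.filter (· < mid))) (SR.int (l.filter (¬ · < mid))))
  ov l k := own SL.s 2 (nslot SL SR mid l) (k + 1)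
  K l := ((log SL.K SR.K mid l).length - 1) / 2

theorem log_step (SL SR : Str) (hL : SL.Valid) (hR : SR.Valid) (hs : SL.s = SR.s) (mid : ℝ) (l : List ℝ)
    (hcL : (log SL.K SR.K mid l).count true = SL.K (l.filter (· < mid)))
    (hcR : (log SL.K SR.K mid l).count false = SR.K (l.filter (¬ · < mid))) (x : ℝ) :
    ((log SL.K SR.K mid (x :: l)).count true = SL.K ((x :: l).filter (· < mid)) ∧
    (log SL.K SR.K mid (x :: l)).count false = SR.K ((x :: l).filter (¬ · < mid))) ∧
    (((nslot SL SR mid (x :: l) = nslot SL SR mid l ∧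
      log SL.K SR.K mid (x :: l) = log SL.K SR.K mid l) ∧
      ∃ i < SL.A + SR.A, Upd
      (glue SL.A (SL.int (l.filter (· < mid))) (SR.int (l.filter (¬ · < mid))))
      (glue SL.A (SL.int ((x :: l).filter (· < mid))) (SR.int ((x :: l).filter (¬ · < mid)))) i x) ∨
     (glue SL.A (SL.int ((x :: l).filter (· < mid))) (SR.int ((x :: l).filter (¬ · < mid))) =
      glue SL.A (SL.int (l.filter (· < mid))) (SR.int (l.filter (¬ · < mid))) ∧
      SStep SL.s (nslot SL SR mid l) (nslot SL SR mid (x :: l))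
        (log SL.K SR.K mid l).length (log SL.K SR.K mid (x :: l)).length x)) := by
  by_cases hx : x < mid
  · have e1 : (x :: l).filter (· < mid) = x :: l.filter (· < mid) := by simp [hx]
    have e2 : (x :: l).filter (¬ · < mid) = l.filter (¬ · < mid) := by simp [hx]
    have e3 : log SL.K SR.K mid (x :: l) =
      if SL.K (x :: l.filter (· < mid)) = (log SL.K SR.K mid l).count true then log SL.K SR.K mid l
        else log SL.K SR.K mid l ++ [true] := by
      rw [log, if_pos hx, hcL]
    have hb2 : ∀ d, d ≠ true → both SL SR mid (x :: l) d = both SL SR mid l d := by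
      intro d hd
      cases d
      · simp only [both, e2]
      · simp at hd
    rcases hL.step (l.filter (· < mid)) x with ⟨i, hi, h1, h2, h3⟩ | ⟨h1, h2⟩
    · rw [h3, if_pos hcL.symm] at e3
      rw [e1, e2, e3]
      refine ⟨⟨by rw [h3, hcL], hcR⟩, Or.inl ⟨⟨?_, rfl⟩, i, by omega, h1.glue_left hi _⟩⟩
      unfold nslot
      rw [e3]
      congr 1
      funext d
      cases d
      · exact hb2 _ (by simp)
      · simp only [both, e1, h2]
    · have := merge_step (u := both SL SR mid l) (u' := both SL SR mid (x :: l)) (c := true)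
        (lg := log SL.K SR.K mid l) hb2 (K' := SL.K (x :: l.filter (· < mid))) (x := x) (s := SL.s)
        (by simp only [both, e1, hcL]; exact h2)
        (fun k hk o => hL.ov_none _ _ (by rwa [← hcL]) _)
      unfold nslot
      rw [e1, e2, h1, e3]
      refine ⟨⟨this.1, ?_⟩, Or.inr ⟨rfl, this.2⟩⟩
      split_ifs
      · exact hcR
      · rw [List.count_append]; simpa using hcR
  · have e1 : (x :: l).filter (¬ · < mid) = x :: l.filter (¬ · < mid) :=
      List.filter_cons_of_pos (decide_eq_true hx)
    have e2 : (x :: l).filter (· < mid) = l.filter (· < mid) := by simp [hx]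
    have e3 : log SL.K SR.K mid (x :: l) =
      if SR.K (x :: l.filter (¬ · < mid)) = (log SL.K SR.K mid l).count false then log SL.K SR.K mid l
        else log SL.K SR.K mid l ++ [false] := by
      rw [log, if_neg hx, hcR]
    have hb2 : ∀ d, d ≠ false → both SL SR mid (x :: l) d = both SL SR mid l d := by
      intro d hd
      cases d
      · simp at hd
      · simp only [both, e2]
    rcases hR.step (l.filter (¬ · < mid)) x with ⟨i, hi, h1, h2, h3⟩ | ⟨h1, h2⟩
    · rw [h3, if_pos hcR.symm] at e3
      rw [e1, e2, e3]
      refine ⟨⟨hcL, by rw [h3, hcR]⟩, Or.inl ⟨⟨?_, rfl⟩, SL.A + i, by omega, h1.glue_right _ _⟩⟩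
      unfold nslot
      rw [e3]
      congr 1
      funext d
      cases d
      · simp only [both, e1, h2]
      · exact hb2 _ (by simp)
    · have := merge_step (u := both SL SR mid l) (u' := both SL SR mid (x :: l)) (c := false)
        (lg := log SL.K SR.K mid l) hb2 (K' := SR.K (x :: l.filter (¬ · < mid))) (x := x) (s := SL.s)
        (by simp only [both, e1, hcR]; rw [hs]; exact h2)
        (fun k hk o => hR.ov_none _ _ (by rwa [← hcR]) _)
      unfold nslot
      rw [e1, e2, h1, e3]
      refine ⟨⟨?_, this.1⟩, Or.inr ⟨rfl, this.2⟩⟩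
      split_ifs
      · exact hcL
      · rw [List.count_append]; simpa using hcL

theorem log_count (SL SR : Str) (hL : SL.Valid) (hR : SR.Valid) (hs : SL.s = SR.s) (mid : ℝ)
    (l : List ℝ) :
    (log SL.K SR.K mid l).count true = SL.K (l.filter (· < mid)) ∧
    (log SL.K SR.K mid l).count false = SR.K (l.filter (¬ · < mid)) := by
  induction l with
  | nil => simp [log, hL.K_nil, hR.K_nil]
  | cons x l ih => exact (log_step SL SR hL hR hs mid l ih.1 ih.2 x).1

theorem nslot_mem {SL SR : Str} (hL : SL.Valid) (hR : SR.Valid) {mid : ℝ} {l : List ℝ} {r o : ℕ}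
    {x : ℝ} (h : nslot SL SR mid l r o = some x) : x ∈ l := by
  obtain ⟨c, k, h⟩ := slotOf_mem h
  cases c
  · exact List.mem_of_mem_filter (hR.ov_mem _ _ _ _ h)
  · exact List.mem_of_mem_filter (hL.ov_mem _ _ _ _ h)

theorem nslot_none {SL SR : Str} {mid : ℝ} {l : List ℝ} {r : ℕ}
    (h : (log SL.K SR.K mid l).length ≤ r) (o : ℕ) : nslot SL SR mid l r o = none := by
  unfold nslot; rw [slotOf_none h]

theorem node_valid (SL SR : Str) (hL : SL.Valid) (hR : SR.Valid) (hs : SL.s = SR.s) (mid : ℝ) :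
    (node SL SR mid).Valid where
  int_nil i := by
    simp only [node, glue, List.filter_nil]
    split_ifs
    · simp only [own, cat]
      split_ifs
      · exact nslot_none (by simp [log]) _
      · rfl
    · exact hL.int_nil _
    · exact hR.int_nil _
  K_nil := by simp [node, log]
  ov_none l k hk o := own_none (by norm_num) (fun r hr o => nslot_none hr o) k hk o
  int_mem l i x h := by
    simp only [node, glue] at h
    split_ifs at h
    · obtain ⟨r, o, h⟩ := own_mem h
      exact nslot_mem hL hR h
    · exact List.mem_of_mem_filter (hL.int_mem _ _ _ h)
    · exact List.mem_of_mem_filter (hR.int_mem _ _ _ h)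
  ov_mem l k o x h := by
    obtain ⟨r, o, h⟩ := own_mem h
    exact nslot_mem hL hR h
  step l x := by
    obtain ⟨c1, c2⟩ := log_count SL SR hL hR hs mid l
    rcases (log_step SL SR hL hR hs mid l c1 c2 x).2 with ⟨⟨h1, h2⟩, i, hi, h3⟩ | ⟨h1, h2⟩
    · left
      refine ⟨2 * SL.s + i, by simp only [node]; omega, ?_, ?_, ?_⟩
      · simp only [node, h1]
        exact h3.glue_right _ _
      · simp only [node, h1]
      · simp only [node, h2]
    · rcases pack_step (p := 2) (by norm_num) h2 with ⟨i, hi, g1, g2, g3⟩ | ⟨g1, g2⟩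
      · left
        refine ⟨i, by simp only [node]; omega, ?_, funext g2, g3⟩
        simp only [node, h1]
        exact g1.glue_left hi _
      · right
        refine ⟨?_, g2⟩
        simp only [node, h1, g1]

theorem node_phi (SL SR : Str) (hL : SL.Valid) (hR : SR.Valid) (hs : SL.s = SR.s) {a w : ℝ}
    (hw : 0 ≤ w) {l : List ℝ} (hl : ∀ x ∈ l, a ≤ x ∧ x ≤ a + w) :
    (node SL SR (a + w / 2)).Phi a w l ≤
      SL.Phi a (w / 2) (l.filter (· < a + w / 2)) +
      SR.Phi (a + w / 2) (w / 2) (l.filter (¬ · < a + w / 2)) +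
      3 * w * ((SL.K (l.filter (· < a + w / 2)) + SR.K (l.filter (¬ · < a + w / 2)) : ℕ) : ℝ) := by
  set mid := a + w / 2 with hmid
  obtain ⟨c1, c2⟩ := log_count SL SR hL hR hs mid l
  have hlen : (log SL.K SR.K mid l).length =
      SL.K (l.filter (· < mid)) + SR.K (l.filter (¬ · < mid)) := by
    rw [← c1, ← c2, List.count_true_add_count_false]
  have h := pack_cost (s := SL.s) (p := 2) (by norm_num) (t := nslot SL SR mid l)
    (R := (log SL.K SR.K mid l).length) (a := a) hw (fun r hr o => nslot_none hr o)
    (fun r o x h => hl x (nslot_mem hL hR h))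
    (vals (SL.int (l.filter (· < mid))) SL.A ++ vals (SR.int (l.filter (¬ · < mid))) SR.A ++ [a + w])
  have h2 : ∑ r ∈ Finset.range (log SL.K SR.K mid l).length, V (vals (nslot SL SR mid l r) SL.s) =
    _ := sum_slotOf (log SL.K SR.K mid l) (both SL SR mid l) (fun f => V (vals f SL.s))
  rw [h2, c1, c2] at h
  have h3 := V_delete (a :: vals (SL.int (l.filter (· < mid))) SL.A)
    (vals (SR.int (l.filter (¬ · < mid))) SR.A ++ [a + w]) mid
  rw [V_split] at h3
  have h4 : mid + w / 2 = a + w := by rw [hmid]; ring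
  unfold Str.Phi
  have e1 : (node SL SR mid).A = 2 * SL.s + (SL.A + SR.A) := rfl
  have e2 : (node SL SR mid).s = 2 * SL.s := rfl
  have e3 : (node SL SR mid).int l = glue (2 * SL.s) (own SL.s 2 (nslot SL SR mid l) 0)
    (glue SL.A (SL.int (l.filter (· < mid))) (SR.int (l.filter (¬ · < mid)))) := rfl
  have e4 : ∀ k, (node SL SR mid).ov l k = own SL.s 2 (nslot SL SR mid l) (k + 1) := fun _ => rfl
  have e5 : (node SL SR mid).K l = ((log SL.K SR.K mid l).length - 1) / 2 := rfl
  rw [e1, e3, vals_glue, vals_glue, e2, e5, h4]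
  simp only [e4]
  rw [Finset.sum_add_distrib (s := Finset.range (SL.K _)),
    Finset.sum_add_distrib (s := Finset.range (SR.K _))]
  have p1 : 0 ≤ ∑ k ∈ Finset.range (SL.K (l.filter (· < mid))), 2 * (w / 2) :=
    Finset.sum_nonneg (fun _ _ => by linarith)
  have p2 : 0 ≤ ∑ k ∈ Finset.range (SR.K (l.filter (¬ · < mid))), 2 * (w / 2) :=
    Finset.sum_nonneg (fun _ _ => by linarith)
  rw [← hlen]
  simp only [both, List.append_assoc, List.cons_append, hs] at h h3 ⊢
  linarith

theorem exists_str (q : ℕ) (hq : 0 < q) (h : ℕ) : ∀ (a w : ℝ), 0 ≤ w → ∃ S : Str, S.Valid ∧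
    S.A = 2 ^ h * q * (h + 1) ∧ S.s = 2 ^ h * q ∧ ∀ l : List ℝ, S.K l * S.s ≤ l.length ∧
      ((∀ x ∈ l, a ≤ x ∧ x ≤ a + w) → S.Phi a w l ≤
        w + 3 * (w / 2 ^ h) * l.length + 6 * h * (w / 2 ^ h) * l.length / q) := by
  have hq' : (0 : ℝ) < q := by exact_mod_cast hq
  induction h with
  | zero =>
    intro a w hw
    refine ⟨leaf q, leaf_valid hq, by simp [leaf], by simp [leaf], fun l => ⟨?_, fun hl => ?_⟩⟩
    · simp only [leaf, mul_one]
      have := Nat.div_mul_le_self (l.length - 1) q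
      omega
    · have := leaf_phi hq hw hl
      simpa using this
  | succ h ih =>
    intro a w hw
    obtain ⟨SL, vL, AL, sL, bL⟩ := ih a (w / 2) (by linarith)
    obtain ⟨SR, vR, AR, sR, bR⟩ := ih (a + w / 2) (w / 2) (by linarith)
    have hs : SL.s = SR.s := by rw [sL, sR]
    refine ⟨node SL SR (a + w / 2), node_valid SL SR vL vR hs _, ?_, ?_, fun l => ?_⟩
    · simp only [node, AL, AR, sL]; ring
    · simp only [node, sL]; ring
    · obtain ⟨kL, fL⟩ := bL (l.filter (· < a + w / 2))
      obtain ⟨kR, fR⟩ := bR (l.filter (¬ · < a + w / 2))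
      have hlen : (l.filter (· < a + w / 2)).length + (l.filter (¬ · < a + w / 2)).length
          = l.length := by
        have := List.length_eq_length_filter_add (l := l) (fun x => decide (x < a + w / 2))
        rw [this]
        congr 2
        apply List.filter_congr
        intro x _
        simp only [decide_not]
      rw [sL] at kL
      rw [sR] at kR
      obtain ⟨c1, c2⟩ := log_count SL SR vL vR hs (a + w / 2) l
      have hlog : (log SL.K SR.K (a + w / 2) l).length =
          SL.K (l.filter (· < a + w / 2)) + SR.K (l.filter (¬ · < a + w / 2)) := by
        rw [← c1, ← c2, List.count_true_add_count_false]
      constructor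
      · simp only [node, sL]
        rw [hlog]
        generalize SL.K _ = x at *
        generalize SR.K _ = y at *
        calc (x + y - 1) / 2 * (2 * (2 ^ h * q)) = ((x + y - 1) / 2 * 2) * (2 ^ h * q) := by ring
          _ ≤ (x + y) * (2 ^ h * q) := Nat.mul_le_mul_right _ (by omega)
          _ = x * (2 ^ h * q) + y * (2 ^ h * q) := by ring
          _ ≤ _ := by omega
      · intro hl
        have hphi := node_phi SL SR vL vR hs hw hl
        have f1 := fL (by
          intro x hx
          rw [List.mem_filter] at hx
          have := hl x hx.1
          have h2 := of_decide_eq_true hx.2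
          exact ⟨this.1, h2.le⟩)
        have f2 := fR (by
          intro x hx
          rw [List.mem_filter] at hx
          have := hl x hx.1
          have h2 := of_decide_eq_true hx.2
          constructor
          · exact not_lt.1 h2
          · linarith [this.2])
        rw [← hlen]
        generalize SL.Phi _ _ _ = P1 at *
        generalize SR.Phi _ _ _ = P2 at *
        generalize SL.K _ = x at *
        generalize SR.K _ = y at *
        generalize List.length (List.filter (· < a + w / 2) l) = n1 at *
        generalize List.length (List.filter (¬ · < a + w / 2) l) = n2 at *
        have hk : ((x + y : ℕ) : ℝ) * (2 ^ h * q) ≤ n1 + n2 := by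
          have : (x + y) * (2 ^ h * q) ≤ n1 + n2 := by rw [add_mul]; omega
          exact_mod_cast this
        have hk' : ((x + y : ℕ) : ℝ) ≤ (n1 + n2) / (2 ^ h * q) := by
          rw [le_div_iff₀ (by positivity)]; exact hk
        have hk2 := mul_le_mul_of_nonneg_left hk' (show 0 ≤ 3 * w by linarith)
        refine hphi.trans ((add_le_add (add_le_add f1 f2) hk2).trans (le_of_eq ?_))
        push_cast
        field_simp
        ring

/-- a one-phase data structure of capacity `N` in `Sz` cells -/
structure Ph (F : List ℝ → ℕ → Option ℝ) (N Sz : ℕ) (a w c : ℝ) : Prop where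
  nil : ∀ i, F [] i = none
  step : ∀ l x, (x :: l).length ≤ N → ∃ i < Sz, Upd (F l) (F (x :: l)) i x
  cost : ∀ l, l.length ≤ N → (∀ x ∈ l, a ≤ x ∧ x ≤ a + w) → V (vals (F l) Sz) ≤ c * w

theorem Ph.facts {F : List ℝ → ℕ → Option ℝ} {N Sz : ℕ} {a w c : ℝ} (h : Ph F N Sz a w c)
    (l : List ℝ) (hl : l.length ≤ N) :
    (∀ i, Sz ≤ i → F l i = none) ∧ ∀ i x, F l i = some x → x ∈ l := by
  induction l with
  | nil => exact ⟨fun i _ => h.nil i, fun i x hx => by rw [h.nil] at hx; cases hx⟩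
  | cons y l ih =>
    obtain ⟨ih1, ih2⟩ := ih (by simp at hl; omega)
    obtain ⟨i, hi, h1, h2, h3⟩ := h.step l y hl
    constructor
    · intro j hj
      rw [h3 j (by omega)]
      exact ih1 j hj
    · intro j x hx
      by_cases hj : j = i
      · rw [hj, h2] at hx
        cases hx
        simp
      · rw [h3 j hj] at hx
        exact List.mem_cons_of_mem _ (ih2 j x hx)

theorem Str.lin {S : Str} (hS : S.Valid) (hs : 0 < S.s) {N : ℕ} {a w c : ℝ} (hw : 0 ≤ w)
    (hK : ∀ l : List ℝ, S.K l * S.s ≤ l.length)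
    (hc : ∀ l : List ℝ, l.length ≤ N → (∀ x ∈ l, a ≤ x ∧ x ≤ a + w) → S.Phi a w l + w ≤ c * w) :
    Ph (fun l => glue S.A (S.int l) (cat S.s (S.ov l))) N (S.A + N / S.s * S.s) a w c where
  nil i := by
    simp only [glue, cat]
    split_ifs
    · exact hS.int_nil _
    · exact hS.ov_none _ _ (by rw [hS.K_nil]; exact Nat.zero_le _) _
  step l x hl := by
    rcases hS.step l x with ⟨i, hi, h1, h2, h3⟩ | ⟨h1, r, o, ho, hr, -, hu, hne⟩
    · exact ⟨i, by omega, by simp only [h2]; exact h1.glue_left hi _⟩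
    · refine ⟨S.A + (r * S.s + o), ?_, ?_⟩
      · have h4 : r < N / S.s := by
          have := (Nat.le_div_iff_mul_le hs).2 ((hK (x :: l)).trans hl)
          omega
        have h5 : (r + 1) * S.s ≤ N / S.s * S.s := Nat.mul_le_mul_right _ h4
        rw [add_mul, one_mul] at h5
        omega
      · simp only [h1]
        exact (Upd.cat ho hu hne).glue_right _ _
  cost l hl hin := by
    refine le_trans ?_ (hc l hl hin)
    rw [vals_glue]
    have h1 := V_append_le (vals (S.int l) S.A) (vals (cat S.s (S.ov l)) (N / S.s * S.s)) w hw (by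
      intro x hx y hy
      obtain ⟨i, _, hx⟩ := mem_vals.1 hx
      obtain ⟨j, _, hy⟩ := mem_vals_cat hy
      obtain ⟨i', _, hy⟩ := mem_vals.1 hy
      have h1 := hin _ (hS.int_mem _ _ _ hx)
      have h2 := hin _ (hS.ov_mem _ _ _ _ hy)
      rw [abs_le]; constructor <;> linarith)
    have h2 := V_cat S.s (N / S.s) (S.K l) (S.ov l) 0 a w hw (hS.ov_none l)
      (fun r o x hx => hin _ (hS.ov_mem _ _ _ _ hx))
    simp only [zero_add] at h2
    have h3 := sum_trunc (N / S.s) (S.K l) (fun k => V (vals (S.ov l k) S.s) + w)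
      (fun r => add_nonneg (V_nonneg _) hw)
    have h4 : ∑ k ∈ Finset.range (S.K l), (V (vals (S.ov l k) S.s) + w) ≤
      ∑ k ∈ Finset.range (S.K l), (V (vals (S.ov l k) S.s) + 2 * w) :=
      Finset.sum_le_sum (fun k _ => by linarith)
    have h5 := V_delete (vals (S.int l) S.A) [] (a + w)
    have h6 := V_tail_le a (vals (S.int l) S.A ++ [a + w])
    simp only [List.append_nil] at h5
    unfold Str.Phi
    linarith

theorem exists_phase {L γ : ℝ} (hL : 1 ≤ L) (hγ : 1 ≤ γ) (hγL : γ ≤ L ^ 2) (k : ℕ)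
    (hk : (k : ℝ) ≤ L + 1) : ∃ Sz : ℕ, (Sz : ℝ) ≤ 7 * γ * 2 ^ k ∧ ∀ a w : ℝ, 0 ≤ w →
      ∃ F, Ph F (2 ^ k) Sz a w (32 * (L ^ 2 / γ)) := by
  have hγ0 : 0 < γ := by linarith
  have hL2 : 1 ≤ L ^ 2 / γ := by rwa [le_div_iff₀ hγ0, one_mul]
  obtain ⟨h, hh1, hh2⟩ := exists_nat_pow_near (le_max_left 1 (2 ^ k * γ / L ^ 2)) (one_lt_two (α := ℝ))
  set q := min ⌈L⌉₊ (2 ^ k) with hqdef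
  have hq : 0 < q := lt_min (Nat.ceil_pos.2 (by linarith)) (by positivity)
  have hq' : (0 : ℝ) < q := by exact_mod_cast hq
  have hqL : (q : ℝ) ≤ 2 * L := by
    have h1 : (q : ℝ) ≤ (⌈L⌉₊ : ℝ) := by exact_mod_cast min_le_left _ _
    have := Nat.ceil_lt_add_one (show 0 ≤ L by linarith)
    linarith
  have hqk : q ≤ 2 ^ k := min_le_right _ _
  -- case facts
  have hcase : h = 0 ∨ ((2 : ℝ) ^ h ≤ 2 ^ k * γ / L ^ 2 ∧ h ≤ k) := by
    rcases Nat.eq_zero_or_pos h with h0 | h0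
    · exact Or.inl h0
    · right
      have h2 : (1 : ℝ) < 2 ^ h := one_lt_pow₀ (by norm_num) (by omega)
      have h3 : (2 : ℝ) ^ h ≤ 2 ^ k * γ / L ^ 2 := by
        rcases le_max_iff.1 hh1 with h | h
        · linarith
        · exact h
      refine ⟨h3, ?_⟩
      have h4 : 2 ^ k * γ / L ^ 2 ≤ (2 : ℝ) ^ k := by
        rw [div_le_iff₀ (by positivity)]
        exact mul_le_mul_of_nonneg_left hγL (by positivity)
      exact (pow_le_pow_iff_right₀ (one_lt_two (α := ℝ))).1 (h3.trans h4)
  have hsp : (2 : ℝ) ^ h * q * (h + 1) + 2 ^ k ≤ 7 * γ * 2 ^ k := by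
    have hp : (0 : ℝ) < 2 ^ k := by positivity
    have hg : (2 : ℝ) ^ k ≤ γ * 2 ^ k := le_mul_of_one_le_left hp.le hγ
    rcases hcase with h0 | ⟨h1, h2⟩
    · subst h0
      have : (q : ℝ) ≤ 2 ^ k := by exact_mod_cast hqk
      norm_num
      linarith
    · have h3 : (h : ℝ) + 1 ≤ 3 * L := by
        have : (h : ℝ) ≤ k := by exact_mod_cast h2
        linarith
      have : (2 : ℝ) ^ h * q * (h + 1) ≤ 2 ^ k * γ / L ^ 2 * (2 * L) * (3 * L) := by gcongr
      have e : 2 ^ k * γ / L ^ 2 * (2 * L) * (3 * L) = 6 * γ * 2 ^ k := by field_simp; ring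
      linarith
  have hhq : (h : ℝ) ≤ 2 * q := by
    rcases hcase with h0 | ⟨h1, h2⟩
    · subst h0; simp
    · have h3 : (h : ℝ) ≤ k := by exact_mod_cast h2
      rcases min_choice ⌈L⌉₊ (2 ^ k) with h4 | h4
      · rw [hqdef, h4]
        have := Nat.le_ceil L
        linarith
      · rw [hqdef, h4]
        have : k < 2 ^ k := Nat.lt_two_pow_self
        have : (k : ℝ) ≤ (2 ^ k : ℕ) := by exact_mod_cast this.le
        linarith
  have hN : (2 : ℝ) ^ k / 2 ^ h ≤ 2 * (L ^ 2 / γ) := by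
    have h1 : 2 ^ k * γ / L ^ 2 < 2 ^ h * 2 := by
      rw [← pow_succ]; exact (le_max_right _ _).trans_lt hh2
    rw [div_lt_iff₀ (by positivity)] at h1
    rw [div_le_iff₀ (by positivity), ← mul_div_assoc, div_mul_eq_mul_div, le_div_iff₀ hγ0]
    linarith
  refine ⟨2 ^ h * q * (h + 1) + 2 ^ k / (2 ^ h * q) * (2 ^ h * q), ?_, fun a w hw => ?_⟩
  · have h1 : 2 ^ h * q * (h + 1) + 2 ^ k / (2 ^ h * q) * (2 ^ h * q) ≤ 2 ^ h * q * (h + 1) + 2 ^ k :=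
      Nat.add_le_add_left (Nat.div_mul_le_self _ _) _
    have h2 : ((2 ^ h * q * (h + 1) + 2 ^ k / (2 ^ h * q) * (2 ^ h * q) : ℕ) : ℝ) ≤
      ((2 ^ h * q * (h + 1) + 2 ^ k : ℕ) : ℝ) := by exact_mod_cast h1
    refine h2.trans ?_
    push_cast
    exact hsp
  · obtain ⟨S, vS, hA, hs, hb⟩ := exists_str q hq h a w hw
    rw [← hA, ← hs]
    refine ⟨_, Str.lin vS (by rw [hs]; positivity) hw (fun l => (hb l).1) (fun l hl hin => ?_)⟩
    have h1 := (hb l).2 hin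
    have hlr : (l.length : ℝ) ≤ 2 ^ k := by exact_mod_cast hl
    have h2 : w / 2 ^ h * l.length ≤ w * (2 * (L ^ 2 / γ)) := by
      calc w / 2 ^ h * l.length ≤ w / 2 ^ h * 2 ^ k := by gcongr
        _ = w * (2 ^ k / 2 ^ h) := by ring
        _ ≤ _ := by gcongr
    have h3 : 6 * h * (w / 2 ^ h) * l.length / q ≤ 12 * (w / 2 ^ h * l.length) := by
      rw [div_le_iff₀ hq']
      have := mul_le_mul_of_nonneg_right hhq (show 0 ≤ 6 * (w / 2 ^ h * l.length) by positivity)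
      linarith
    have h4 : w ≤ L ^ 2 / γ * w := le_mul_of_one_le_left hw hL2
    linarith

/-- invariant of the doubling-phases algorithm -/
structure Inv' (L γ : ℝ) (l : List ℝ) (f : ℕ → Option ℝ) (base Sz k : ℕ) (lo hi : ℝ)
    (cur : List ℝ) (old : ℕ → Option ℝ) (E : ℕ) (F : List ℝ → ℕ → Option ℝ) : Prop where
  hk : (k : ℝ) ≤ L + 1
  lohi : lo ≤ hi
  lo_mem : lo ∈ l
  hi_mem : hi ∈ l
  range : ∀ x ∈ l, lo - (hi - lo) ≤ x ∧ x ≤ hi + (hi - lo)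
  hf : f = glue base old (F cur)
  cur_pos : 1 ≤ cur.length
  cur_le : cur.length ≤ 2 ^ k
  cur_sub : ∀ x ∈ cur, x ∈ l
  len : E + cur.length = l.length
  space : (base : ℝ) + 7 * γ * 2 ^ k ≤ 7 * γ * (3 * E + 1)
  old_mem : ∀ i x, old i = some x → x ∈ l
  ph : Ph F (2 ^ k) Sz (lo - (hi - lo)) (3 * (hi - lo)) (32 * (L ^ 2 / γ))
  size : (Sz : ℝ) ≤ 7 * γ * 2 ^ k
  cost : V (vals old base) ≤ 3 * (32 * (L ^ 2 / γ) + 1) * (hi - lo) * (L + 2 + k)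

def Inv (L γ : ℝ) (l : List ℝ) (f : ℕ → Option ℝ) : Prop :=
  (l = [] ∧ f = fun _ => none) ∨ ∃ base Sz k lo hi cur old E F,
    Inv' L γ l f base Sz k lo hi cur old E F

theorem newphase {L γ : ℝ} (hL : 1 ≤ L) (hγ : 1 ≤ γ) (hγL : γ ≤ L ^ 2) {n m : ℕ}
    (hm : ∀ z : ℕ, (z : ℝ) ≤ 7 * γ * (3 * n + 1) → z ≤ m) {l : List ℝ} (hl : l.length ≤ n) {x : ℝ}
    {f : ℕ → Option ℝ} {B k : ℕ} {lo hi : ℝ} (hk : (k : ℝ) ≤ L + 1) (lohi : lo ≤ hi)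
    (lo_mem : lo ∈ x :: l) (hi_mem : hi ∈ x :: l)
    (range : ∀ y ∈ x :: l, lo - (hi - lo) ≤ y ∧ y ≤ hi + (hi - lo))
    (fnone : ∀ i, B ≤ i → f i = none) (fmem : ∀ i y, f i = some y → y ∈ l)
    (space : (B : ℝ) + 7 * γ * 2 ^ k ≤ 7 * γ * (3 * l.length + 1))
    (cost : V (vals f B) ≤ 3 * (32 * (L ^ 2 / γ) + 1) * (hi - lo) * (L + 2 + k)) :
    ∃ f' i, i < m ∧ Upd f f' i x ∧ Inv L γ (x :: l) f' := by
  obtain ⟨Sz, hSz, hF⟩ := exists_phase hL hγ hγL k hk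
  obtain ⟨F, hF⟩ := hF (lo - (hi - lo)) (3 * (hi - lo)) (by linarith)
  obtain ⟨i, hi', hu⟩ := hF.step [] x (by simp [Nat.one_le_two_pow])
  refine ⟨glue B f (F [x]), B + i, ?_, ?_, Or.inr ⟨B, Sz, k, lo, hi, [x], f, l.length, F, ?_⟩⟩
  · have : B + Sz ≤ m := by
      apply hm
      push_cast
      have hln : (l.length : ℝ) ≤ n := by exact_mod_cast hl
      have : 7 * γ * (3 * l.length + 1) ≤ 7 * γ * (3 * n + 1) := by gcongr
      linarith
    omega
  · have e : f = glue B f (F []) := by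
      funext j
      simp only [glue]
      split_ifs with h
      · rfl
      · rw [hF.nil, fnone _ (by omega)]
    have := hu.glue_right B f
    rwa [← e] at this
  · exact
    { hk := hk
      lohi := lohi
      lo_mem := lo_mem
      hi_mem := hi_mem
      range := range
      hf := rfl
      cur_pos := by simp
      cur_le := by simp [Nat.one_le_two_pow]
      cur_sub := by simp
      len := by simp
      space := space
      old_mem := fun i y h => List.mem_cons_of_mem _ (fmem i y h)
      ph := hF
      size := hSz
      cost := cost }

theorem Inv'.facts {L γ : ℝ} (hL : 1 ≤ L) (hγ : 1 ≤ γ) {l : List ℝ} {f : ℕ → Option ℝ}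
    {base Sz k : ℕ} {lo hi : ℝ}
    {cur : List ℝ} {old : ℕ → Option ℝ} {E : ℕ} {F : List ℝ → ℕ → Option ℝ}
    (h : Inv' L γ l f base Sz k lo hi cur old E F) :
    (∀ i, base + Sz ≤ i → f i = none) ∧ (∀ i y, f i = some y → y ∈ l) ∧
    V (vals f (base + Sz)) ≤ 3 * (32 * (L ^ 2 / γ) + 1) * (hi - lo) * (L + 2 + k + 1) := by
  obtain ⟨g1, g2⟩ := h.ph.facts cur h.cur_le
  have hR : 0 ≤ hi - lo := by linarith [h.lohi]
  refine ⟨?_, ?_, ?_⟩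
  · intro i hi
    rw [h.hf]
    simp only [glue]
    rw [if_neg (by omega), g1 _ (by omega)]
  · intro i y hy
    rw [h.hf] at hy
    simp only [glue] at hy
    split_ifs at hy
    · exact h.old_mem _ _ hy
    · exact h.cur_sub _ (g2 _ _ hy)
  · rw [h.hf, vals_glue]
    have h1 := V_append_le (vals old base) (vals (F cur) Sz) (3 * (hi - lo)) (by linarith) (by
      intro x hx y hy
      obtain ⟨i, _, hx⟩ := mem_vals.1 hx
      obtain ⟨j, _, hy⟩ := mem_vals.1 hy
      have h1 := h.range _ (h.old_mem _ _ hx)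
      have h2 := h.range _ (h.cur_sub _ (g2 _ _ hy))
      rw [abs_le]; constructor <;> linarith)
    have h2 := h.ph.cost cur h.cur_le (by
      intro x hx
      have := h.range _ (h.cur_sub _ hx)
      constructor <;> linarith)
    have h3 := h.cost
    linarith

theorem Inv.step {L γ : ℝ} (hL : 1 ≤ L) (hγ : 1 ≤ γ) (hγL : γ ≤ L ^ 2) {n m : ℕ}
    (hn : 1 ≤ n) (hLn : L = Real.logb 2 n)
    (hm : ∀ z : ℕ, (z : ℝ) ≤ 7 * γ * (3 * n + 1) → z ≤ m) {l : List ℝ} (hl : l.length < n)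
    {f : ℕ → Option ℝ} (h : Inv L γ l f) (x : ℝ) :
    ∃ f' i, i < m ∧ Upd f f' i x ∧ Inv L γ (x :: l) f' := by
  have hγ0 : 0 < γ := by linarith
  rcases h with ⟨rfl, rfl⟩ | ⟨base, Sz, k, lo, hi, cur, old, E, F, h⟩
  · refine newphase hL hγ hγL hm (by simp) (B := 0) (k := 0) (lo := x) (hi := x)
      (by push_cast; linarith) le_rfl (by simp)
      (by simp) (by simp) (by simp) (by simp) (by simp) (by simp [vals, V])
  · obtain ⟨g1, g2, g3⟩ := h.facts hL hγ
    have hlohi := h.lohi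
    have hrange := h.range
    have hk := h.hk
    have hsz := h.size
    have hsp := h.space
    have hcp : (1 : ℝ) ≤ cur.length := by exact_mod_cast h.cur_pos
    have hlen : (E : ℝ) + cur.length = l.length := by exact_mod_cast h.len
    have hQ : 0 ≤ 3 * (32 * (L ^ 2 / γ) + 1) * (hi - lo) :=
      mul_nonneg (by positivity) (by linarith)
    by_cases hx : lo - (hi - lo) ≤ x ∧ x ≤ hi + (hi - lo)
    · have hr : ∀ y ∈ x :: l, lo - (hi - lo) ≤ y ∧ y ≤ hi + (hi - lo) := by
        intro y hy
        rcases List.mem_cons.1 hy with rfl | hy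
        · exact hx
        · exact hrange y hy
      by_cases hc : cur.length < 2 ^ k
      · obtain ⟨i, hi', hu⟩ := h.ph.step cur x (by simpa using hc)
        refine ⟨glue base old (F (x :: cur)), base + i, ?_, ?_,
          Or.inr ⟨base, Sz, k, lo, hi, x :: cur, old, E, F, ?_⟩⟩
        · have : base + Sz ≤ m := by
            apply hm
            push_cast
            have hln : (E : ℝ) ≤ n := by
              have := h.len
              exact_mod_cast (by omega : E ≤ n)
            have : 7 * γ * (3 * E + 1) ≤ 7 * γ * (3 * n + 1) := by gcongr
            linarith
          omega
        · rw [h.hf]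
          exact hu.glue_right _ _
        · exact
          { hk := hk
            lohi := hlohi
            lo_mem := List.mem_cons_of_mem _ h.lo_mem
            hi_mem := List.mem_cons_of_mem _ h.hi_mem
            range := hr
            hf := rfl
            cur_pos := by simp
            cur_le := by simpa using hc
            cur_sub := by
              intro y hy
              rcases List.mem_cons.1 hy with rfl | hy
              · simp
              · exact List.mem_cons_of_mem _ (h.cur_sub y hy)
            len := by have := h.len; simp; omega
            space := hsp
            old_mem := fun i y hy => List.mem_cons_of_mem _ (h.old_mem i y hy)
            ph := h.ph
            size := hsz
            cost := h.cost }
      · have hfull : cur.length = 2 ^ k := le_antisymm h.cur_le (not_lt.1 hc)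
        have hfullr : (cur.length : ℝ) = 2 ^ k := by exact_mod_cast hfull
        refine newphase hL hγ hγL hm hl.le (B := base + Sz) (k := k + 1) (lo := lo) (hi := hi) ?_
          hlohi (List.mem_cons_of_mem _ h.lo_mem) (List.mem_cons_of_mem _ h.hi_mem) hr g1 g2 ?_ ?_
        · push_cast
          have h1 : ((2 : ℝ) ^ k) ≤ n := by
            rw [← hfullr]
            have := h.len
            exact_mod_cast (by omega : cur.length ≤ n)
          have h2 : (k : ℝ) ≤ L := by
            rw [hLn, Real.le_logb_iff_rpow_le (by norm_num) (by positivity), Real.rpow_natCast]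
            exact h1
          linarith
        · push_cast
          have h1 : 7 * γ * (3 * l.length + 1) = 7 * γ * (3 * E + 1) + 21 * γ * 2 ^ k := by
            rw [← hlen, hfullr]; ring
          rw [h1, pow_succ]
          linarith
        · push_cast
          refine g3.trans (le_of_eq (by ring))
    · have hspace : ((base + Sz : ℕ) : ℝ) + 7 * γ * 2 ^ 0 ≤ 7 * γ * (3 * l.length + 1) := by
        push_cast
        have h1 : 7 * γ * (3 * l.length + 1) = 7 * γ * (3 * E + 1) + 21 * γ * cur.length := by
          rw [← hlen]; ring
        have h2 : 21 * γ * 1 ≤ 21 * γ * cur.length := by gcongr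
        rw [h1]
        linarith
      have hcost : ∀ R', 2 * (hi - lo) ≤ R' → V (vals f (base + Sz)) ≤
          3 * (32 * (L ^ 2 / γ) + 1) * R' * (L + 2 + (0 : ℕ)) := by
        intro R' hR'
        refine g3.trans ?_
        calc _ ≤ 3 * (32 * (L ^ 2 / γ) + 1) * (hi - lo) * (2 * (L + 2)) :=
              mul_le_mul_of_nonneg_left (by linarith) hQ
          _ = 3 * (32 * (L ^ 2 / γ) + 1) * (2 * (hi - lo)) * (L + 2 + (0 : ℕ)) := by push_cast; ring
          _ ≤ _ := by gcongr
      by_cases hx1 : x < lo - (hi - lo)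
      · refine newphase hL hγ hγL hm hl.le (B := base + Sz) (k := 0) (lo := x) (hi := hi)
          (by push_cast; linarith) (by linarith) (by simp) (List.mem_cons_of_mem _ h.hi_mem) ?_ g1 g2
          hspace (hcost _ (by linarith))
        intro y hy
        rcases List.mem_cons.1 hy with rfl | hy
        · constructor <;> linarith
        · have := hrange y hy
          constructor <;> linarith
      · have hx2 : hi + (hi - lo) < x := by
          by_contra hc
          exact hx ⟨not_lt.1 hx1, not_lt.1 hc⟩
        refine newphase hL hγ hγL hm hl.le (B := base + Sz) (k := 0) (lo := lo) (hi := x)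
          (by push_cast; linarith) (by linarith) (List.mem_cons_of_mem _ h.lo_mem) (by simp) ?_ g1 g2
          hspace (hcost _ (by linarith))
        intro y hy
        rcases List.mem_cons.1 hy with rfl | hy
        · constructor <;> linarith
        · have := hrange y hy
          constructor <;> linarith

theorem Inv.final {L γ : ℝ} (hL : 1 ≤ L) (hγ : 1 ≤ γ) (hγL : γ ≤ L ^ 2) {n m : ℕ}
    (hm : ∀ z : ℕ, (z : ℝ) ≤ 7 * γ * (3 * n + 1) → z ≤ m) {l : List ℝ} (hl : l.length = n)
    {f : ℕ → Option ℝ} (h : Inv L γ l f) {D : ℝ} (hD : ∀ x ∈ l, ∀ y ∈ l, x - y ≤ D) (hD0 : 0 ≤ D) :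
    V (vals f m) ≤ 594 * L ^ 3 / γ * D := by
  have hγ0 : 0 < γ := by linarith
  have hL2 : 1 ≤ L ^ 2 / γ := by rwa [le_div_iff₀ hγ0, one_mul]
  rcases h with ⟨rfl, rfl⟩ | ⟨base, Sz, k, lo, hi, cur, old, E, F, h⟩
  · rw [vals_none (fun _ _ => rfl)]
    simp only [V]
    positivity
  · obtain ⟨g1, g2, g3⟩ := h.facts hL hγ
    have hsz := h.size
    have hsp := h.space
    have hk := h.hk
    have hle : base + Sz ≤ m := by
      apply hm
      push_cast
      have hln : (E : ℝ) ≤ n := by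
        have := h.len
        exact_mod_cast (by omega : E ≤ n)
      have : 7 * γ * (3 * E + 1) ≤ 7 * γ * (3 * n + 1) := by gcongr
      linarith
    obtain ⟨d, rfl⟩ := Nat.exists_eq_add_of_le hle
    rw [vals_add, vals_none (f := fun i => f (base + Sz + i)) (fun i _ => g1 _ (by omega)),
      List.append_nil]
    refine g3.trans ?_
    have h1 : hi - lo ≤ D := hD _ h.hi_mem _ h.lo_mem
    have h0 : 0 ≤ hi - lo := by linarith [h.lohi]
    calc _ ≤ 3 * (32 * (L ^ 2 / γ) + 1 * (L ^ 2 / γ)) * D * (6 * L) := by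
          gcongr
          · linarith
          · linarith
      _ = 594 * L ^ 3 / γ * D := by ring

theorem vals_succ (f : ℕ → Option ℝ) (N : ℕ) :
    vals f (N + 1) = (f 0).toList ++ vals (fun i => f (i + 1)) N := by
  unfold vals
  rw [List.range_succ_eq_map, List.filterMap_cons, List.filterMap_map]
  cases h : f 0 <;> rfl

theorem first_cost (x : ℝ) (N : ℕ) : ∀ f : ℕ → Option ℝ,
    (∑ j : Fin N, if (f j).isSome = true ∧ ∀ k : Fin N, k < j → f k = none then
      |x - (f j).getD 0| else 0) + V (vals f N) = V (x :: vals f N) := by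
  induction N with
  | zero => intro f; simp [vals, V]
  | succ N ih =>
    intro f
    rw [Fin.sum_univ_succ, vals_succ]
    cases h : f 0 with
    | none =>
      have e := ih (fun i => f (i + 1))
      rw [if_neg (by simp [h]), zero_add]
      simp only [Option.toList_none, List.nil_append]
      rw [← e]
      congr 1
      refine Finset.sum_congr rfl (fun j _ => if_congr ?_ (by simp) rfl)
      simp [Fin.forall_fin_succ, h]
    | some y =>
      rw [if_pos (by simp [h]), Finset.sum_eq_zero]
      · simp [h, V]
      · intro j _
        rw [if_neg]
        rintro ⟨_, hk⟩
        have := hk 0 (Fin.succ_pos j)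
        simp [h] at this

theorem configCost_eq (N : ℕ) : ∀ f : ℕ → Option ℝ,
    configCost (fun i : Fin N => f i) = V (vals f N) := by
  induction N with
  | zero => intro f; simp [configCost, vals, V]
  | succ N ih =>
    intro f
    have e := ih (fun i => f (i + 1))
    have e2 : configCost (fun i : Fin (N + 1) => f i) =
        (∑ j : Fin N, if (f 0).isSome = true ∧ (f (j + 1)).isSome = true ∧
          ∀ k : Fin N, k < j → f (k + 1) = none then |(f 0).getD 0 - (f (j + 1)).getD 0| else 0)
        + configCost (fun i : Fin N => f (i + 1)) := by
      unfold configCost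
      rw [Fin.sum_univ_succ]
      congr 1
      · rw [Fin.sum_univ_succ, if_neg (by simp), zero_add]
        refine Finset.sum_congr rfl (fun j _ => if_congr ?_ (by simp) rfl)
        simp [Fin.forall_fin_succ]
      · refine Finset.sum_congr rfl (fun i _ => ?_)
        rw [Fin.sum_univ_succ, if_neg (by simp), zero_add]
        refine Finset.sum_congr rfl (fun j _ => if_congr ?_ (by simp) rfl)
        simp [Fin.forall_fin_succ]
    rw [e2, e, vals_succ]
    cases h : f 0 with
    | none => simp
    | some x =>
      have := first_cost x N (fun i => f (i + 1))
      simp only [Option.toList_some, List.singleton_append]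
      rw [← this]
      congr 1
      refine Finset.sum_congr rfl (fun j _ => if_congr ?_ (by simp) rfl)
      simp

/-- content after processing a list (newest first) -/
def GG (N : List ℝ → (ℕ → Option ℝ) → ℝ → ℕ → Option ℝ) : List ℝ → ℕ → Option ℝ
  | [] => fun _ => none
  | x :: l => N l (GG N l) x

def cell (I : List ℝ → (ℕ → Option ℝ) → ℝ → ℕ)
    (N : List ℝ → (ℕ → Option ℝ) → ℝ → ℕ → Option ℝ) : List ℝ → ℕ
  | [] => 0
  | x :: l => I l (GG N l) x

theorem online {n m : ℕ} (hm : 0 < m) (P : List ℝ → (ℕ → Option ℝ) → Prop)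
    (h0 : P [] (fun _ => none))
    (hstep : ∀ l f, l.length < n → P l f → ∀ x, ∃ f' i, i < m ∧ Upd f f' i x ∧ P (x :: l) f') :
    ∃ strat : List ℝ → Fin m, ∀ a : Fin n → ℝ, Function.Injective (place strat a) ∧
      ∃ f, P (List.ofFn a).reverse f ∧ configCost (config a (place strat a)) = V (vals f m) := by
  have hst : ∀ l f x, ∃ f' i, i < m ∧ (l.length < n → P l f → Upd f f' i x ∧ P (x :: l) f') := by
    intro l f x
    by_cases h : l.length < n ∧ P l f
    · obtain ⟨f', i, hi, h1, h2⟩ := hstep l f h.1 h.2 x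
      exact ⟨f', i, hi, fun _ _ => ⟨h1, h2⟩⟩
    · exact ⟨f, 0, hm, fun a b => absurd ⟨a, b⟩ h⟩
  choose N I hI hNI using hst
  have hP : ∀ l, l.length ≤ n → P l (GG N l) := by
    intro l
    induction l with
    | nil => intro _; exact h0
    | cons x l ih =>
      intro hl
      simp only [List.length_cons] at hl
      exact (hNI l _ x (by omega) (ih (by omega))).2
  have hU : ∀ l x, l.length < n → Upd (GG N l) (GG N (x :: l)) (cell I N (x :: l)) x :=
    fun l x hl => (hNI l _ x hl (hP l hl.le)).1
  have hc : ∀ l, cell I N l < m := by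
    intro l
    cases l with
    | nil => exact hm
    | cons x l => exact hI _ _ _
  refine ⟨fun p => ⟨cell I N p.reverse, hc _⟩, fun a => ?_⟩
  set pl := place (fun p => (⟨cell I N p.reverse, hc _⟩ : Fin m)) a with hpl
  have hlt : ∀ s (hs : s < n), ((List.ofFn a).take (s + 1)).reverse =
      a ⟨s, hs⟩ :: ((List.ofFn a).take s).reverse := by
    intro s hs
    rw [List.take_add_one, List.reverse_append]
    simp [hs]
  have hplv : ∀ t : Fin n, (pl t).1 = cell I N (a t :: ((List.ofFn a).take t.1).reverse) := by
    intro t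
    rw [← hlt t.1 t.2]
    rfl
  have hUt : ∀ t : Fin n, Upd (GG N ((List.ofFn a).take t.1).reverse)
      (GG N ((List.ofFn a).take (t.1 + 1)).reverse) (pl t).1 (a t) := by
    intro t
    rw [hplv, hlt t.1 t.2]
    apply hU
    simp
  have main : ∀ s, s ≤ n →
      (∀ t : Fin n, t.1 < s → GG N ((List.ofFn a).take s).reverse (pl t).1 = some (a t)) ∧
      (∀ i, (∀ t : Fin n, t.1 < s → (pl t).1 ≠ i) →
        GG N ((List.ofFn a).take s).reverse i = none) := by
    intro s
    induction s with
    | zero => intro _; exact ⟨by simp, fun i _ => by simp [GG]⟩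
    | succ s ih =>
      intro hs
      obtain ⟨i1, i2⟩ := ih (by omega)
      obtain ⟨u1, u2, u3⟩ := hUt ⟨s, by omega⟩
      dsimp only at u1 u2 u3
      constructor
      · intro t ht
        by_cases hts : t.1 = s
        · have : t = ⟨s, by omega⟩ := Fin.ext hts
          rw [this]
          exact u2
        · have h1 := i1 t (by omega)
          rw [u3, h1]
          intro hc
          rw [hc, u1] at h1
          cases h1
      · intro i hi
        rw [u3 i (fun hc => hi ⟨s, by omega⟩ (by simp) hc.symm)]
        exact i2 i (fun t ht => hi t (by omega))
  have hlt' : ∀ t t' : Fin n, t.1 < t'.1 → pl t ≠ pl t' := by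
    intro t t' htt hc
    have h1 := (main t'.1 t'.2.le).1 t htt
    rw [hc, (hUt t').1] at h1
    cases h1
  refine ⟨?_, GG N (List.ofFn a).reverse, hP _ (by simp), ?_⟩
  · intro t t' htt
    rcases lt_trichotomy t.1 t'.1 with h | h | h
    · exact absurd htt (hlt' _ _ h)
    · exact Fin.ext h
    · exact absurd htt.symm (hlt' _ _ h)
  · rw [← configCost_eq]
    congr 1
    funext i
    have hmn := main n le_rfl
    rw [List.take_of_length_le (by simp)] at hmn
    unfold config
    split_ifs with h
    · have := hmn.1 h.choose h.choose.2
      rw [h.choose_spec] at this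
      exact this.symm
    · refine (hmn.2 _ (fun t _ hc => h ⟨t, Fin.ext hc⟩)).symm

end OS

theorem statement6 :
    ∃ C : ℝ, 0 < C ∧
      ∀ n : ℕ, 2 ≤ n → ∀ γ : ℝ, 1 ≤ γ → γ ≤ (Real.logb 2 n) ^ 2 →
        ∃ m : ℕ, (m : ℝ) ≤ C * γ * n ∧
          ∃ strat : List ℝ → Fin m,
            ∀ a : Fin n → ℝ,
              Function.Injective (place strat a) ∧
              configCost (config a (place strat a)) ≤
                (C * (Real.logb 2 n) ^ 3 / γ) * ((⨆ t, a t) - (⨅ t, a t)) := by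
  refine ⟨594, by norm_num, fun n hn γ hγ hγL => ?_⟩
  have hnr : (2 : ℝ) ≤ n := by exact_mod_cast hn
  have hL : 1 ≤ Real.logb 2 n := by
    rw [Real.le_logb_iff_rpow_le (by norm_num) (by linarith), Real.rpow_one]
    exact hnr
  have hm : ∀ z : ℕ, (z : ℝ) ≤ 7 * γ * (3 * n + 1) → z ≤ ⌊7 * γ * (3 * n + 1)⌋₊ :=
    fun z hz => Nat.le_floor hz
  refine ⟨⌊7 * γ * (3 * n + 1)⌋₊, ?_, ?_⟩
  · refine (Nat.floor_le (by positivity)).trans ?_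
    have : γ * 2 ≤ γ * n := by gcongr
    nlinarith
  · have hpos : 0 < ⌊7 * γ * (3 * n + 1)⌋₊ := hm 1 (by
      push_cast
      nlinarith)
    obtain ⟨strat, hs⟩ := OS.online (n := n) hpos (OS.Inv (Real.logb 2 n) γ) (Or.inl ⟨rfl, rfl⟩)
      (fun l f hl h x => OS.Inv.step hL hγ hγL (by omega) rfl hm hl h x)
    refine ⟨strat, fun a => ⟨(hs a).1, ?_⟩⟩
    obtain ⟨f, hf, hcost⟩ := (hs a).2
    rw [hcost]
    have hle : ∀ t t', a t - a t' ≤ (⨆ t, a t) - (⨅ t, a t) := by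
      intro t t'
      have h1 := le_ciSup (Set.finite_range a).bddAbove t
      have h2 := ciInf_le (Set.finite_range a).bddBelow t'
      linarith
    refine OS.Inv.final hL hγ hγL hm (by simp) hf ?_ ?_
    · intro x hx y hy
      simp only [List.mem_reverse, List.mem_ofFn] at hx hy
      obtain ⟨t, rfl⟩ := hx
      obtain ⟨t', rfl⟩ := hy
      exact hle t t'
    · have := hle ⟨0, by omega⟩ ⟨0, by omega⟩
      linarith
end
end
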